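/- arXiv:1508.00845 — 3 statements merged into one kernel-verified Lean document; each statement's English description precedes it below -/
import Mathlib

section
/- Every m-invariant measure ν of the subcritical BGW process killed at 0 is a nonnegative multiple of the Yaglom limit: there exists c ≥ 0 such that ν(j) = c·ν_min(j) for all j ≥ 1. -/
open MeasureTheory Real Set

/-- `convPow q i j` is the `i`-fold convolution power of the offspring distribution `q`
evaluated at `j`, i.e. the transition matrix `P₀(i,j)` of the BGW process. -/
noncomputable def convPow (q : ℕ → ℝ) : ℕ → ℕ → ℝ
  | 0, j => if j = 0 then 1 else 0
  | i + 1, j => ∑ k ∈ Finset.range (j + 1), convPow q i (j - k) * q k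

/-- `ν` is a `lam`-invariant measure on `ℕ* = {1,2,…}` of the BGW process killed at 0. -/
def IsInvMeasure (q : ℕ → ℝ) (lam : ℝ) (ν : ℕ → ℝ) : Prop :=
  (∀ n, 0 ≤ ν n) ∧ ν 0 = 0 ∧
  ∀ j : ℕ, 1 ≤ j →
    Summable (fun i => ν i * convPow q i j) ∧
    ∑' i, ν i * convPow q i j = lam * ν j

open Filter Topology

lemma hs_congr {f g : ℕ → ℝ} {a : ℝ} (h : ∀ i, f i = g i) : HasSum f a ↔ HasSum g a := by
  rw [funext h]

/-- generating function -/
noncomputable def gf (a : ℕ → ℝ) (s : ℝ) : ℝ := ∑' i, a i * s ^ i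

lemma gf_summable {a : ℕ → ℝ} (ha : ∀ n, 0 ≤ a n) (hs : Summable a) {s : ℝ} (h0 : 0 ≤ s)
    (h1 : s ≤ 1) : Summable (fun i => a i * s ^ i) :=
  Summable.of_nonneg_of_le (fun i => mul_nonneg (ha i) (pow_nonneg h0 i))
    (fun i => mul_le_of_le_one_right (ha i) (pow_le_one₀ h0 h1)) hs

lemma gf_one (a : ℕ → ℝ) : gf a 1 = ∑' i, a i := by simp [gf]

lemma gf_zero (a : ℕ → ℝ) : gf a 0 = a 0 := by
  unfold gf
  rw [tsum_eq_single 0]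
  · simp
  · intro b hb; simp [hb]

lemma gf_mono {a : ℕ → ℝ} (ha : ∀ n, 0 ≤ a n) (hs : Summable a) {x y : ℝ} (h0 : 0 ≤ x)
    (hxy : x ≤ y) (h1 : y ≤ 1) : gf a x ≤ gf a y :=
  (gf_summable ha hs h0 (hxy.trans h1)).tsum_le_tsum
    (fun i => mul_le_mul_of_nonneg_left (pow_le_pow_left₀ h0 hxy i) (ha i))
    (gf_summable ha hs (h0.trans hxy) h1)

lemma gf_nonneg {a : ℕ → ℝ} (ha : ∀ n, 0 ≤ a n) {x : ℝ} (h0 : 0 ≤ x) : 0 ≤ gf a x :=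
  tsum_nonneg (fun i => mul_nonneg (ha i) (pow_nonneg h0 i))

lemma one_sub_pow_eq (x : ℝ) (k : ℕ) : 1 - x ^ k = (1 - x) * ∑ i ∈ Finset.range k, x ^ i := by
  rw [mul_neg_geom_sum]

lemma gf_sub_hasSum {a : ℕ → ℝ} (ha : ∀ n, 0 ≤ a n) (hs : Summable a) {x : ℝ} (h0 : 0 ≤ x)
    (h1 : x ≤ 1) : HasSum (fun i => a i * (1 - x ^ i)) (gf a 1 - gf a x) := by
  have := (gf_summable ha hs zero_le_one le_rfl).hasSum.sub (gf_summable ha hs h0 h1).hasSum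
  refine (hs_congr (fun i => ?_)).1 this
  rw [one_pow]; ring

lemma gf_slope {a : ℕ → ℝ} (ha : ∀ n, 0 ≤ a n) (hs : Summable a) {x y : ℝ} (h0 : 0 ≤ x)
    (hxy : x ≤ y) (h1 : y ≤ 1) :
    (gf a 1 - gf a x) * (1 - y) ≤ (gf a 1 - gf a y) * (1 - x) := by
  refine hasSum_le (fun i => ?_) ((gf_sub_hasSum ha hs h0 (hxy.trans h1)).mul_right (1 - y))
    ((gf_sub_hasSum ha hs (h0.trans hxy) h1).mul_right (1 - x))
  rw [one_sub_pow_eq, one_sub_pow_eq]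
  have : ∑ j ∈ Finset.range i, x ^ j ≤ ∑ j ∈ Finset.range i, y ^ j :=
    Finset.sum_le_sum (fun j _ => pow_le_pow_left₀ h0 hxy j)
  have h2 : 0 ≤ a i * (1 - x) * (1 - y) :=
    mul_nonneg (mul_nonneg (ha i) (by linarith)) (by linarith)
  nlinarith [mul_le_mul_of_nonneg_left this h2]

lemma gf_deriv_tendsto {q : ℕ → ℝ} (hq0 : ∀ k, 0 ≤ q k) (hq1 : Summable q) {m : ℝ}
    (hm : HasSum (fun k : ℕ => (k : ℝ) * q k) m) {x : ℕ → ℝ} (hx0 : ∀ n, 0 ≤ x n)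
    (hx1 : ∀ n, x n < 1) (hx : Tendsto x atTop (𝓝 1)) :
    Tendsto (fun n => (gf q 1 - gf q (x n)) / (1 - x n)) atTop (𝓝 m) := by
  have h1 : ∀ n, (gf q 1 - gf q (x n)) / (1 - x n)
      = ∑' k, q k * ∑ i ∈ Finset.range k, x n ^ i := by
    intro n
    have hp : 0 < 1 - x n := by linarith [hx1 n]
    rw [← (gf_sub_hasSum hq0 hq1 (hx0 n) (hx1 n).le).tsum_eq, ← tsum_div_const]
    congr 1; ext k
    rw [one_sub_pow_eq]; field_simp
  simp_rw [h1]
  rw [← hm.tsum_eq]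
  refine tendsto_tsum_of_dominated_convergence hm.summable ?_ ?_
  · intro k
    have : Tendsto (fun n => q k * ∑ i ∈ Finset.range k, x n ^ i) atTop
        (𝓝 (q k * ∑ i ∈ Finset.range k, (1:ℝ) ^ i)) :=
      (tendsto_finsetSum _ (fun i _ => hx.pow i)).const_mul _
    simpa [mul_comm] using this
  · refine Eventually.of_forall (fun n k => ?_)
    have h2 : ∑ i ∈ Finset.range k, x n ^ i ≤ k := by
      calc _ ≤ ∑ i ∈ Finset.range k, (1:ℝ) :=
            Finset.sum_le_sum (fun i _ => pow_le_one₀ (hx0 n) (hx1 n).le)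
        _ = k := by simp
    have h3 : 0 ≤ ∑ i ∈ Finset.range k, x n ^ i :=
      Finset.sum_nonneg (fun i _ => pow_nonneg (hx0 n) i)
    rw [Real.norm_of_nonneg (mul_nonneg (hq0 k) h3), mul_comm]
    exact mul_le_mul_of_nonneg_right h2 (hq0 k)

lemma convPow_nonneg {q : ℕ → ℝ} (hq0 : ∀ k, 0 ≤ q k) (i j : ℕ) : 0 ≤ convPow q i j := by
  induction i generalizing j with
  | zero => unfold convPow; split_ifs <;> norm_num
  | succ i ih =>
    unfold convPow
    exact Finset.sum_nonneg (fun k _ => mul_nonneg (ih _) (hq0 k))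

lemma convPow_zero_right (q : ℕ → ℝ) (i : ℕ) : convPow q i 0 = q 0 ^ i := by
  induction i with
  | zero => simp [convPow]
  | succ i ih => simp [convPow, ih, pow_succ]

lemma convPow_lower {q : ℕ → ℝ} (hq0 : ∀ k, 0 ≤ q k) (i j : ℕ) :
    q 0 ^ i * q j ≤ convPow q (i+1) j := by
  rw [convPow]
  have := Finset.single_le_sum (f := fun k => convPow q i (j - k) * q k)
    (fun k _ => mul_nonneg (convPow_nonneg hq0 _ _) (hq0 k)) (Finset.self_mem_range_succ j)
  simpa [convPow_zero_right] using this

lemma convPow_hasSum {q : ℕ → ℝ} (hq0 : ∀ k, 0 ≤ q k) (hq1 : Summable q) {s : ℝ} (h0 : 0 ≤ s)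
    (h1 : s ≤ 1) (i : ℕ) : HasSum (fun j => convPow q i j * s ^ j) (gf q s ^ i) := by
  induction i with
  | zero =>
    have := hasSum_ite_eq (0:ℕ) (1:ℝ)
    rw [pow_zero]
    refine (hs_congr (fun j => ?_)).1 this
    by_cases hj : j = 0 <;> simp [convPow, hj]
  | succ i ih =>
    have hf := gf_summable hq0 hq1 h0 h1
    have := hasSum_sum_range_mul_of_summable_norm ih.summable.norm hf.norm
    rw [ih.tsum_eq] at this
    have hp : gf q s ^ (i+1) = gf q s ^ i * ∑' k, q k * s ^ k := by rw [pow_succ]; rfl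
    rw [hp]
    refine (hs_congr (fun n => ?_)).1 this
    rw [convPow, Finset.sum_mul, ← Finset.sum_range_reflect]
    refine Finset.sum_congr rfl (fun k hk => ?_)
    have hk' : k ≤ n := by have := Finset.mem_range.1 hk; omega
    have e : n + 1 - 1 - k = n - k := by omega
    have e2 : n - (n - k) = k := by omega
    rw [e, e2]
    have e3 : s ^ n = s ^ (n - k) * s ^ k := by rw [← pow_add]; congr 1; omega
    rw [e3]; ring

lemma fubini {q : ℕ → ℝ} (hq0 : ∀ k, 0 ≤ q k) (hq1 : Summable q) {m : ℝ} {ν : ℕ → ℝ}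
    (hν : IsInvMeasure q m ν) {s : ℝ} (h0 : 0 ≤ s) (h1 : s ≤ 1)
    (hs : Summable (fun i => ν i * s ^ i)) :
    HasSum (fun i => ν i * (gf q s ^ i - q 0 ^ i)) (m * gf ν s) := by
  obtain ⟨hν0, hνz, hinv⟩ := hν
  have hnn : ∀ p : ℕ × ℕ, 0 ≤ ν p.2 * convPow q p.2 (p.1+1) * s ^ (p.1+1) := fun p =>
    mul_nonneg (mul_nonneg (hν0 _) (convPow_nonneg hq0 _ _)) (pow_nonneg h0 _)
  have hcol : ∀ j, HasSum (fun i => ν i * convPow q i (j+1) * s ^ (j+1))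
      (m * (ν (j+1) * s ^ (j+1))) := by
    intro j
    obtain ⟨ha, hb⟩ := hinv (j+1) (by omega)
    have := (hb ▸ ha.hasSum).mul_right (s ^ (j+1))
    rwa [mul_assoc] at this
  have hrow : ∀ i, HasSum (fun j => ν i * convPow q i (j+1) * s ^ (j+1))
      (ν i * (gf q s ^ i - q 0 ^ i)) := by
    intro i
    have := (hasSum_nat_add_iff' 1).2 (convPow_hasSum hq0 hq1 h0 h1 i)
    simp only [Finset.range_one, Finset.sum_singleton, pow_zero, mul_one,
      convPow_zero_right] at this
    simpa [mul_assoc] using this.mul_left (ν i)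
  have htot : HasSum (fun j => m * (ν (j+1) * s ^ (j+1))) (m * gf ν s) := by
    have := (hasSum_nat_add_iff' 1).2 hs.hasSum
    simp only [Finset.range_one, Finset.sum_singleton, hνz, zero_mul, sub_zero] at this
    exact this.mul_left m
  have hsum : Summable (fun p : ℕ × ℕ => ν p.2 * convPow q p.2 (p.1+1) * s ^ (p.1+1)) := by
    rw [summable_prod_of_nonneg hnn]
    refine ⟨fun j => (hcol j).summable, ?_⟩
    simp_rw [fun j => (hcol j).tsum_eq]
    exact htot.summable
  have h3 := hsum.hasSum.prod_fiberwise hcol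
  have h4 : HasSum (fun p : ℕ × ℕ => ν p.1 * convPow q p.1 (p.2+1) * s ^ (p.2+1)) _ :=
    (Equiv.prodComm ℕ ℕ).hasSum_iff.2 hsum.hasSum
  rw [htot.unique h3]
  exact h4.prod_fiberwise hrow

/-- iterates of the generating function -/
noncomputable def it (q : ℕ → ℝ) (n : ℕ) (s : ℝ) : ℝ := (gf q)^[n] s

lemma it_succ (q : ℕ → ℝ) (n : ℕ) (s : ℝ) : it q (n+1) s = gf q (it q n s) :=
  Function.iterate_succ_apply' _ _ _

lemma it_add (q : ℕ → ℝ) (n k : ℕ) (s : ℝ) : it q (n+k) s = it q n (it q k s) :=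
  Function.iterate_add_apply _ _ _ _

lemma gf_q_one {q : ℕ → ℝ} (hq1 : HasSum q 1) : gf q 1 = 1 := by rw [gf_one, hq1.tsum_eq]

lemma exists_pos {q : ℕ → ℝ} (hq0 : ∀ k, 0 ≤ q k) 
    {m : ℝ} (hm : HasSum (fun k : ℕ => (k : ℝ) * q k) m) (hm0 : 0 < m) :
    ∃ j, 1 ≤ j ∧ 0 < q j := by
  by_contra! h
  have : ∀ k : ℕ, (k:ℝ) * q k = 0 := by
    intro k
    rcases Nat.eq_zero_or_pos k with rfl | hk
    · simp
    · simp [le_antisymm (h k hk) (hq0 k)]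
  simp_rw [this] at hm
  exact hm0.ne (hasSum_zero.unique hm)

lemma gf_q_nonneg {q : ℕ → ℝ} (hq0 : ∀ k, 0 ≤ q k) (hq1 : HasSum q 1)
    {s : ℝ} (h0 : 0 ≤ s) : 0 ≤ gf q s := gf_nonneg hq0 h0

lemma gf_q_lt {q : ℕ → ℝ} (hq0 : ∀ k, 0 ≤ q k) (hq1 : HasSum q 1) {m : ℝ} (hm : HasSum (fun k : ℕ => (k : ℝ) * q k) m) (hm0 : 0 < m)
    {s : ℝ} (h0 : 0 ≤ s) (h1 : s < 1) : gf q s < 1 := by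
  obtain ⟨j, hj, hjp⟩ := exists_pos hq0 hm hm0
  have h := gf_sub_hasSum hq0 hq1.summable h0 h1.le
  rw [gf_q_one hq1] at h
  have h2 := le_hasSum h j (fun i _ => mul_nonneg (hq0 i) (by linarith [pow_le_one₀ h0 h1.le (n := i)]))
  have h3 : s ^ j < 1 := pow_lt_one₀ h0 h1 (by omega)
  have : 0 < q j * (1 - s ^ j) := mul_pos hjp (by linarith)
  linarith

lemma gf_q_contr {q : ℕ → ℝ} (hq0 : ∀ k, 0 ≤ q k) (hq1 : HasSum q 1) {m : ℝ} (hm : HasSum (fun k : ℕ => (k : ℝ) * q k) m)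
    {s : ℝ} (h0 : 0 ≤ s) (h1 : s < 1) : 1 - gf q s ≤ m * (1 - s) := by
  have h := gf_sub_hasSum hq0 hq1.summable h0 h1.le
  rw [gf_q_one hq1] at h
  refine hasSum_le (fun k => ?_) h (hm.mul_right (1 - s))
  rw [one_sub_pow_eq]
  have h2 : ∑ i ∈ Finset.range k, s ^ i ≤ k := by
    calc _ ≤ ∑ i ∈ Finset.range k, (1:ℝ) :=
          Finset.sum_le_sum (fun i _ => pow_le_one₀ h0 h1.le)
      _ = k := by simp
  have h3 : 0 ≤ q k * (1 - s) := mul_nonneg (hq0 k) (by linarith)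
  nlinarith [mul_le_mul_of_nonneg_left h2 h3]

lemma it_mem {q : ℕ → ℝ} (hq0 : ∀ k, 0 ≤ q k) (hq1 : HasSum q 1) {m : ℝ} (hm : HasSum (fun k : ℕ => (k : ℝ) * q k) m) (hm0 : 0 < m)
    (n : ℕ) {s : ℝ} (h0 : 0 ≤ s) (h1 : s < 1) : 0 ≤ it q n s ∧ it q n s < 1 := by
  induction n with
  | zero => exact ⟨h0, h1⟩
  | succ n ih =>
    rw [it_succ]
    exact ⟨gf_q_nonneg hq0 hq1 ih.1, gf_q_lt hq0 hq1 hm hm0 ih.1 ih.2⟩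

lemma it_mono {q : ℕ → ℝ} (hq0 : ∀ k, 0 ≤ q k) (hq1 : HasSum q 1) {m : ℝ} (hm : HasSum (fun k : ℕ => (k : ℝ) * q k) m) (hm0 : 0 < m)
    (n : ℕ) {s t : ℝ} (h0 : 0 ≤ s) (hst : s ≤ t) (h1 : t < 1) :
    it q n s ≤ it q n t := by
  induction n with
  | zero => exact hst
  | succ n ih =>
    rw [it_succ, it_succ]
    exact gf_mono hq0 hq1.summable (it_mem hq0 hq1 hm hm0 n h0 (hst.trans_lt h1)).1 ih
      (it_mem hq0 hq1 hm hm0 n (h0.trans hst) h1).2.le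

lemma it_bound {q : ℕ → ℝ} (hq0 : ∀ k, 0 ≤ q k) (hq1 : HasSum q 1) {m : ℝ} (hm : HasSum (fun k : ℕ => (k : ℝ) * q k) m) (hm0 : 0 < m)
    (n : ℕ) {s : ℝ} (h0 : 0 ≤ s) (h1 : s < 1) : 1 - it q n s ≤ m ^ n * (1 - s) := by
  induction n with
  | zero => simp [it]
  | succ n ih =>
    rw [it_succ]
    obtain ⟨ha, hb⟩ := it_mem hq0 hq1 hm hm0 n h0 h1
    have := gf_q_contr hq0 hq1 hm ha hb
    rw [pow_succ]
    nlinarith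

lemma it_tendsto {q : ℕ → ℝ} (hq0 : ∀ k, 0 ≤ q k) (hq1 : HasSum q 1) {m : ℝ} (hm : HasSum (fun k : ℕ => (k : ℝ) * q k) m) (hm0 : 0 < m) (hm1 : m < 1)
    {s : ℝ} (h0 : 0 ≤ s) (h1 : s < 1) :
    Tendsto (fun n => it q n s) atTop (𝓝 1) := by
  have h2 : Tendsto (fun n => 1 - m ^ n * (1 - s)) atTop (𝓝 (1 - 0 * (1 - s))) :=
    ((tendsto_pow_atTop_nhds_zero_of_lt_one hm0.le hm1).mul_const _).const_sub _
  rw [zero_mul, sub_zero] at h2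
  refine tendsto_of_tendsto_of_tendsto_of_le_of_le h2 tendsto_const_nhds ?_ ?_
  · intro n; have := it_bound hq0 hq1 hm hm0 n h0 h1; simp only; linarith
  · intro n; exact (it_mem hq0 hq1 hm hm0 n h0 h1).2.le

lemma ratio_tendsto {q : ℕ → ℝ} (hq0 : ∀ k, 0 ≤ q k) (hq1 : HasSum q 1) {m : ℝ} (hm : HasSum (fun k : ℕ => (k : ℝ) * q k) m) (hm0 : 0 < m) (hm1 : m < 1)
    (k : ℕ) :
    Tendsto (fun n => (1 - it q (n + k) 0) / (1 - it q n 0)) atTop (𝓝 (m ^ k)) := by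
  have hmem := fun n => it_mem hq0 hq1 hm hm0 n le_rfl zero_lt_one
  have hT := it_tendsto hq0 hq1 hm hm0 hm1 le_rfl zero_lt_one
  have hne : ∀ n, 1 - it q n 0 ≠ 0 := fun n => by linarith [(hmem n).2] |> fun h : 0 < 1 - it q n 0 => h.ne'
  induction k with
  | zero =>
    simp only [add_zero, pow_zero]
    simp_rw [div_self (hne _)]
    exact tendsto_const_nhds
  | succ k ih =>
    have h := gf_deriv_tendsto hq0 hq1.summable hm (x := fun n => it q (n+k) 0)
      (fun n => (hmem _).1) (fun n => (hmem _).2)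
      (hT.comp (tendsto_add_atTop_nat k))
    rw [pow_succ]
    refine (ih.mul h).congr (fun n => ?_)
    rw [gf_q_one hq1, ← it_succ, ← add_assoc]
    have := hne (n+k)
    have := hne n
    field_simp

lemma inv_summable_q0 {q : ℕ → ℝ} (hq0 : ∀ k, 0 ≤ q k) (hq1 : HasSum q 1) {m : ℝ} (hm : HasSum (fun k : ℕ => (k : ℝ) * q k) m) (hm0 : 0 < m) {ν : ℕ → ℝ} (hν : IsInvMeasure q m ν)
    : Summable (fun i => ν i * q 0 ^ i) := by
  obtain ⟨j, hj, hjp⟩ := exists_pos hq0 hm hm0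
  have h := (summable_nat_add_iff 1).2 (hν.2.2 j hj).1
  rw [← summable_nat_add_iff 1]
  refine Summable.of_nonneg_of_le (fun i => mul_nonneg (hν.1 _) (pow_nonneg (hq0 0) _))
    (fun i => ?_) (h.mul_left (q 0 / q j))
  have h2 := convPow_lower hq0 i j
  have h3 : 0 ≤ ν (i+1) * (q 0 / q j) := mul_nonneg (hν.1 _) (div_nonneg (hq0 0) hjp.le)
  calc ν (i+1) * q 0 ^ (i+1) = ν (i+1) * (q 0 / q j) * (q 0 ^ i * q j) := by
        rw [pow_succ]; field_simp
    _ ≤ ν (i+1) * (q 0 / q j) * convPow q (i+1) j := mul_le_mul_of_nonneg_left h2 h3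
    _ = _ := by ring

lemma inv_step {q : ℕ → ℝ} (hq0 : ∀ k, 0 ≤ q k) (hq1 : HasSum q 1) {m : ℝ} (hm : HasSum (fun k : ℕ => (k : ℝ) * q k) m) (hm0 : 0 < m) {ν : ℕ → ℝ} (hν : IsInvMeasure q m ν)
    {s : ℝ} (h0 : 0 ≤ s) (h1 : s ≤ 1) (hs : Summable (fun i => ν i * s ^ i)) :
    HasSum (fun i => ν i * gf q s ^ i) (gf ν (q 0) + m * gf ν s) := by
  have h := (inv_summable_q0 hq0 hq1 hm hm0 hν).hasSum.add (fubini hq0 hq1.summable hν h0 h1 hs)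
  refine (hs_congr (fun i => ?_)).1 h
  ring

lemma inv_it {q : ℕ → ℝ} (hq0 : ∀ k, 0 ≤ q k) (hq1 : HasSum q 1) {m : ℝ} (hm : HasSum (fun k : ℕ => (k : ℝ) * q k) m) (hm0 : 0 < m) (hm1 : m < 1) {ν : ℕ → ℝ} (hν : IsInvMeasure q m ν)
    (n : ℕ) : Summable (fun i => ν i * it q n 0 ^ i) ∧
    gf ν (it q n 0) ≤ gf ν (q 0) / (1 - m) := by
  have hnn : 0 ≤ gf ν (q 0) := gf_nonneg hν.1 (hq0 0)
  have hmp : 0 < 1 - m := by linarith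
  induction n with
  | zero =>
    constructor
    · refine summable_of_ne_finset_zero (s := {0}) (fun i hi => ?_)
      have : i ≠ 0 := by simpa using hi
      simp [it, this]
    · simp only [it, Function.iterate_zero, id, gf_zero, hν.2.1]
      positivity
  | succ n ih =>
    obtain ⟨ha, hb⟩ := it_mem hq0 hq1 hm hm0 n le_rfl zero_lt_one
    have h := inv_step hq0 hq1 hm hm0 hν ha hb.le ih.1
    rw [it_succ]
    refine ⟨h.summable, ?_⟩
    have h2 : gf ν (gf q (it q n 0)) = _ := h.tsum_eq
    rw [h2]
    have h3 := mul_le_mul_of_nonneg_left ih.2 hm0.le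
    have h4 : gf ν (q 0) + m * (gf ν (q 0) / (1 - m)) = gf ν (q 0) / (1 - m) := by
      field_simp; ring
    linarith

lemma inv_summable {q : ℕ → ℝ} (hq0 : ∀ k, 0 ≤ q k) (hq1 : HasSum q 1) {m : ℝ} (hm : HasSum (fun k : ℕ => (k : ℝ) * q k) m) (hm0 : 0 < m) (hm1 : m < 1) {ν : ℕ → ℝ} (hν : IsInvMeasure q m ν)
    : Summable ν := by
  refine summable_of_sum_range_le hν.1 (c := gf ν (q 0) / (1 - m)) (fun N => ?_)
  have hT := it_tendsto hq0 hq1 hm hm0 hm1 le_rfl zero_lt_one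
  have h1 : Tendsto (fun n => ∑ i ∈ Finset.range N, ν i * it q n 0 ^ i) atTop
      (𝓝 (∑ i ∈ Finset.range N, ν i * 1 ^ i)) :=
    tendsto_finsetSum _ (fun i _ => (hT.pow i).const_mul _)
  simp only [one_pow, mul_one] at h1
  refine le_of_tendsto' h1 (fun n => ?_)
  obtain ⟨ha, hb⟩ := inv_it hq0 hq1 hm hm0 hm1 hν n
  refine le_trans (ha.sum_le_tsum _ (fun i _ => mul_nonneg (hν.1 i) (pow_nonneg ?_ i))) hb
  exact (it_mem hq0 hq1 hm hm0 n le_rfl zero_lt_one).1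

lemma H_it {q : ℕ → ℝ} (hq0 : ∀ k, 0 ≤ q k) (hq1 : HasSum q 1) {m : ℝ} (hm : HasSum (fun k : ℕ => (k : ℝ) * q k) m) (hm0 : 0 < m) (hm1 : m < 1) {ν : ℕ → ℝ} (hν : IsInvMeasure q m ν)
    (n : ℕ) {s : ℝ} (h0 : 0 ≤ s) (h1 : s < 1) :
    gf ν 1 - gf ν (it q n s) = m ^ n * (gf ν 1 - gf ν s) := by
  have hsum := inv_summable hq0 hq1 hm hm0 hm1 hν
  induction n with
  | zero => simp [it]
  | succ n ih =>
    obtain ⟨ha, hb⟩ := it_mem hq0 hq1 hm hm0 n h0 h1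
    have e1 : gf ν (gf q (it q n s)) = _ :=
      (inv_step hq0 hq1 hm hm0 hν ha hb.le (gf_summable hν.1 hsum ha hb.le)).tsum_eq
    have e2 : gf ν (gf q 1) = _ :=
      (inv_step hq0 hq1 hm hm0 hν zero_le_one le_rfl
        (gf_summable hν.1 hsum zero_le_one le_rfl)).tsum_eq
    rw [gf_q_one hq1] at e2
    rw [it_succ, e1, pow_succ]
    linear_combination m * ih + e2

lemma key {q : ℕ → ℝ} (hq0 : ∀ k, 0 ≤ q k) (hq1 : HasSum q 1) {m : ℝ} (hm : HasSum (fun k : ℕ => (k : ℝ) * q k) m) (hm0 : 0 < m) (hm1 : m < 1) {ν : ℕ → ℝ} (hν : IsInvMeasure q m ν)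
    {μ : ℕ → ℝ} (hμ : IsInvMeasure q m μ) {s : ℝ} (h0 : 0 ≤ s) (h1 : s < 1) :
    gf ν 1 * (gf μ 1 - gf μ s) ≤ gf μ 1 * (gf ν 1 - gf ν s) := by
  have hνs := inv_summable hq0 hq1 hm hm0 hm1 hν
  have hμs := inv_summable hq0 hq1 hm hm0 hm1 hμ
  have hmem := fun n => it_mem hq0 hq1 hm hm0 n le_rfl zero_lt_one
  have hT := it_tendsto hq0 hq1 hm hm0 hm1 le_rfl zero_lt_one
  obtain ⟨k, hk⟩ := (hT.eventually (eventually_ge_nhds h1)).exists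
  have hA : 0 ≤ gf ν 1 := gf_nonneg hν.1 zero_le_one
  have hB : 0 ≤ gf μ 1 := gf_nonneg hμ.1 zero_le_one
  have hmk : 0 < m ^ k := pow_pos hm0 k
  have main : ∀ n, gf ν 1 * (gf μ 1 - gf μ s) * ((1 - it q (n + k) 0) / (1 - it q n 0))
      ≤ m ^ k * (gf μ 1 * (gf ν 1 - gf ν s)) := by
    intro n
    have hmn : 0 < m ^ n := pow_pos hm0 n
    obtain ⟨ha, hb⟩ := it_mem hq0 hq1 hm hm0 n h0 h1
    have hp : 0 < 1 - it q n 0 := by linarith [(hmem n).2]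
    -- first inequality
    have i1 := gf_slope hν.1 hνs (hmem n).1 (it_mono hq0 hq1 hm hm0 n le_rfl h0 h1) hb.le
    rw [H_it hq0 hq1 hm hm0 hm1 hν n le_rfl zero_lt_one, H_it hq0 hq1 hm hm0 hm1 hν n h0 h1,
      gf_zero, hν.2.1, sub_zero, mul_assoc, mul_assoc] at i1
    have i1' := le_of_mul_le_mul_left i1 hmn
    have hle : it q n s ≤ it q (n+k) 0 := by
      rw [it_add]; exact it_mono hq0 hq1 hm hm0 n h0 hk (hmem k).2
    have i2 := gf_slope hμ.1 hμs ha hle (hmem (n+k)).2.le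
    rw [H_it hq0 hq1 hm hm0 hm1 hμ (n+k) le_rfl zero_lt_one, H_it hq0 hq1 hm hm0 hm1 hμ n h0 h1,
      gf_zero, hμ.2.1, sub_zero, pow_add, mul_assoc, mul_assoc, mul_assoc] at i2
    have i2' := le_of_mul_le_mul_left i2 hmn
    rw [← mul_div_assoc, div_le_iff₀ hp]
    have j1 := mul_le_mul_of_nonneg_left i1' (mul_nonneg hmk.le hB)
    have j2 := mul_le_mul_of_nonneg_left i2' hA
    linarith
  have hlim := (ratio_tendsto hq0 hq1 hm hm0 hm1 k).const_mul (gf ν 1 * (gf μ 1 - gf μ s))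
  have := le_of_tendsto' hlim main
  rw [mul_comm] at this
  exact le_of_mul_le_mul_left this hmk

lemma coeff_zero {d : ℕ → ℝ} (hd : Summable d)
    (h : ∀ s : ℝ, 0 < s → s < 1 → ∑' i, d i * s ^ i = 0) (n : ℕ) : d n = 0 := by
  induction n using Nat.strong_induction_on with
  | _ n ih =>
  have hdn : Summable (fun i => |d (i + n)|) := (summable_nat_add_iff n).2 hd.abs
  have h1 : ∀ s : ℝ, 0 < s → s < 1 → ∑' i, d (i + n) * s ^ i = 0 := by
    intro s h0 h1
    have hsum : Summable (fun i => d i * s ^ i) := by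
      refine Summable.of_norm_bounded hd.abs (fun i => ?_)
      rw [norm_mul, Real.norm_eq_abs, Real.norm_of_nonneg (pow_nonneg h0.le i)]
      exact mul_le_of_le_one_right (abs_nonneg _) (pow_le_one₀ h0.le h1.le)
    have h2 := hsum.sum_add_tsum_nat_add n
    rw [h s h0 h1, Finset.sum_eq_zero (fun i hi => by rw [ih i (Finset.mem_range.1 hi), zero_mul]),
      zero_add] at h2
    simp_rw [pow_add, ← mul_assoc] at h2
    rw [tsum_mul_right] at h2
    exact (mul_eq_zero.1 h2).resolve_right (pow_pos h0 n).ne'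
  have h2 : Tendsto (fun s : ℝ => ∑' i, d (i + n) * s ^ i) (𝓝[>] 0)
      (𝓝 (∑' i, d (i + n) * 0 ^ i)) := by
    refine tendsto_tsum_of_dominated_convergence hdn (fun i => ?_) ?_
    · exact ((continuous_const.mul (continuous_pow i)).tendsto 0).mono_left nhdsWithin_le_nhds
    · filter_upwards [Ioo_mem_nhdsGT (zero_lt_one (α := ℝ))] with s hs i
      rw [norm_mul, Real.norm_eq_abs, Real.norm_of_nonneg (pow_nonneg hs.1.le i)]
      exact mul_le_of_le_one_right (abs_nonneg _) (pow_le_one₀ hs.1.le hs.2.le)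
  have h3 : Tendsto (fun s : ℝ => ∑' i, d (i + n) * s ^ i) (𝓝[>] 0) (𝓝 0) := by
    refine tendsto_const_nhds.congr' ?_
    filter_upwards [Ioo_mem_nhdsGT (zero_lt_one (α := ℝ))] with s hs
    exact (h1 s hs.1 hs.2).symm
  have h4 := tendsto_nhds_unique h2 h3
  have h5 := gf_zero (fun i => d (i + n))
  unfold gf at h5
  rw [h4] at h5
  simpa using h5.symm

theorem m_invariant_measures_are_multiples_of_yaglom
    (q : ℕ → ℝ) (hq0 : ∀ k, 0 ≤ q k) (hq1 : HasSum q 1)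
    (m : ℝ) (hm : HasSum (fun k : ℕ => (k : ℝ) * q k) m) (hm0 : 0 < m) (hm1 : m < 1)
    (νmin : ℕ → ℝ) (hmin : IsInvMeasure q m νmin) (hmin1 : HasSum νmin 1)
    (ν : ℕ → ℝ) (hν : IsInvMeasure q m ν) :
    ∃ c : ℝ, 0 ≤ c ∧ ∀ j : ℕ, 1 ≤ j → ν j = c * νmin j := by
  have hνs := inv_summable hq0 hq1 hm hm0 hm1 hν
  refine ⟨gf ν 1, gf_nonneg hν.1 zero_le_one, fun j _ => ?_⟩
  have h1 : gf νmin 1 = 1 := gf_q_one hmin1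
  have := coeff_zero (d := fun i => ν i - gf ν 1 * νmin i) (hνs.sub (hmin1.summable.mul_left _))
    (fun s h0 hs => ?_) j
  · linarith
  · have k1 := key hq0 hq1 hm hm0 hm1 hν hmin h0.le hs
    have k2 := key hq0 hq1 hm hm0 hm1 hmin hν h0.le hs
    rw [h1] at k1 k2
    have k3 : gf ν s - gf ν 1 * gf νmin s = 0 := by linarith
    rw [← k3]
    have a1 := (gf_summable hν.1 hνs h0.le hs.le).hasSum.sub
      ((gf_summable hmin.1 hmin1.summable h0.le hs.le).hasSum.mul_left (gf ν 1))
    refine Eq.trans (tsum_congr fun i => ?_) a1.tsum_eq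
    ring
end

section
/- Let α < 1 and let ν be an m^α-invariant measure of the subcritical BGW process killed at 0. Then the series G(z) = ∑_{n≥1} ν(n)·zⁿ converges for every z ∈ [0,1), and there exists a locally finite Borel measure Λ on (0,∞) satisfying Λ(A) = Λ(mA) for every Borel set A ⊆ (0,∞) such that G(z) = ∫₀^∞ (e^{(H(z)−1)x} − e^{−x})·x^{−α} Λ(dx) for every z ∈ (0,1). -/
open MeasureTheory Real Set

/-- `Λ` is a locally finite Borel measure on `(0,∞)` (viewed as a measure on `ℝ` giving
no mass to `(-∞,0]` and finite mass to compact subsets of `(0,∞)`). -/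
def IsLocFiniteOnPos (Λ : Measure ℝ) : Prop :=
  Λ (Set.Iic 0) = 0 ∧ ∀ K : Set ℝ, IsCompact K → K ⊆ Set.Ioi 0 → Λ K < ⊤

/-- `Λ(A) = Λ(mA)` for every Borel set `A ⊆ (0,∞)`. -/
def ScaleInvariant (m : ℝ) (Λ : Measure ℝ) : Prop :=
  ∀ A : Set ℝ, MeasurableSet A → A ⊆ Set.Ioi 0 →
    Λ A = Λ ((fun x => m * x) '' A)

open Filter Topology
open scoped ENNReal NNReal

namespace BGW

noncomputable def pgf (q : ℕ → ℝ) (z : ℝ) : ℝ := ∑' k, q k * z ^ k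

noncomputable def GE (ν : ℕ → ℝ) (z : ℝ) : ℝ≥0∞ := ∑' n, ENNReal.ofReal (ν n * z ^ n)

lemma convPow_nonneg {q : ℕ → ℝ} (hq0 : ∀ k, 0 ≤ q k) (i j : ℕ) : 0 ≤ convPow q i j := by
  induction i generalizing j with
  | zero => simp only [convPow]; split_ifs <;> norm_num
  | succ i ih =>
    simp only [convPow]
    exact Finset.sum_nonneg fun k _ => mul_nonneg (ih _) (hq0 k)

lemma convPow_zero_right (q : ℕ → ℝ) (i : ℕ) : convPow q i 0 = q 0 ^ i := by
  induction i with
  | zero => simp [convPow]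
  | succ i ih => simp [convPow, ih, pow_succ]

lemma summable_pow {q : ℕ → ℝ} (hq0 : ∀ k, 0 ≤ q k) (hq : Summable q) {z : ℝ}
    (hz : z ∈ Icc (0 : ℝ) 1) : Summable (fun k => q k * z ^ k) :=
  Summable.of_nonneg_of_le (fun k => mul_nonneg (hq0 k) (pow_nonneg hz.1 k))
    (fun k => mul_le_of_le_one_right (hq0 k) (pow_le_one₀ hz.1 hz.2)) hq

lemma pgf_conv {q : ℕ → ℝ} (hq0 : ∀ k, 0 ≤ q k) (hq : Summable q) {z : ℝ}
    (hz : z ∈ Icc (0 : ℝ) 1) (i : ℕ) :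
    Summable (fun j => convPow q i j * z ^ j) ∧ ∑' j, convPow q i j * z ^ j = pgf q z ^ i := by
  induction i with
  | zero =>
    have h : HasSum (fun j => convPow q 0 j * z ^ j) 1 := by
      have := hasSum_ite_eq (0 : ℕ) (1 : ℝ)
      refine this.congr_fun ?_ |> fun h => h
      intro j
      by_cases hj : j = 0 <;> simp [convPow, hj]
    exact ⟨h.summable, by simp [h.tsum_eq]⟩
  | succ i ih =>
    have hs := summable_pow hq0 hq hz
    have e : ∀ j, convPow q (i+1) j * z ^ j =
        ∑ k ∈ Finset.range (j+1), (q k * z ^ k) * (convPow q i (j-k) * z ^ (j-k)) := by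
      intro j
      simp only [convPow, Finset.sum_mul]
      refine Finset.sum_congr rfl fun k hk => ?_
      have : k ≤ j := by simpa [Nat.lt_succ_iff] using hk
      have : z ^ j = z ^ k * z ^ (j-k) := by rw [← pow_add]; congr 1; omega
      rw [this]; ring
    have h1 := hs.norm
    have h2 := ih.1.norm
    simp_rw [e]
    refine ⟨(summable_norm_sum_mul_range_of_summable_norm h1 h2).of_norm, ?_⟩
    rw [← tsum_mul_tsum_eq_tsum_sum_range_of_summable_norm h1 h2, ih.2, pow_succ, mul_comm]
    rfl

lemma pgf_nonneg {q : ℕ → ℝ} (hq0 : ∀ k, 0 ≤ q k) {z : ℝ} (hz : 0 ≤ z) : 0 ≤ pgf q z :=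
  tsum_nonneg fun k => mul_nonneg (hq0 k) (pow_nonneg hz k)

lemma GE_func {q : ℕ → ℝ} (hq0 : ∀ k, 0 ≤ q k) (hq : Summable q) {lam : ℝ} (hl : 0 ≤ lam)
    {ν : ℕ → ℝ} (hν : IsInvMeasure q lam ν) {z : ℝ} (hz : z ∈ Icc (0 : ℝ) 1) :
    GE ν (pgf q z) = ENNReal.ofReal lam * GE ν z + GE ν (q 0) := by
  have P0 := convPow_nonneg hq0
  have e1 : GE ν (pgf q z) =
      ∑' j, ∑' i, ENNReal.ofReal (ν i * convPow q i j) * ENNReal.ofReal (z ^ j) := by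
    rw [ENNReal.tsum_comm]
    unfold GE
    congr 1; ext i
    obtain ⟨hs, ht⟩ := pgf_conv hq0 hq hz i
    rw [← ht, ENNReal.ofReal_mul (hν.1 i), ENNReal.ofReal_tsum_of_nonneg
      (fun j => mul_nonneg (P0 i j) (pow_nonneg hz.1 j)) hs, ← ENNReal.tsum_mul_left]
    congr 1; ext j
    rw [ENNReal.ofReal_mul (hν.1 i), ENNReal.ofReal_mul (P0 i j), mul_assoc]
  rw [e1, tsum_eq_zero_add' ENNReal.summable, add_comm]
  congr 1
  · unfold GE
    rw [← ENNReal.tsum_mul_left, tsum_eq_zero_add' (f := fun i => ENNReal.ofReal lam *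
      ENNReal.ofReal (ν i * z ^ i)) ENNReal.summable]
    simp only [hν.2.1, zero_mul, ENNReal.ofReal_zero, mul_zero, zero_add]
    congr 1; ext j
    rw [ENNReal.tsum_mul_right]
    obtain ⟨hs, ht⟩ := hν.2.2 (j+1) (by omega)
    rw [← ENNReal.ofReal_tsum_of_nonneg (fun i => mul_nonneg (hν.1 i) (P0 i _)) hs, ht,
      ENNReal.ofReal_mul hl, ENNReal.ofReal_mul (hν.1 _), mul_assoc]
  · simp [GE, convPow_zero_right]

lemma GE_q0_lt_top {q : ℕ → ℝ} (hq0 : ∀ k, 0 ≤ q k) (hpos : ∃ j, 1 ≤ j ∧ 0 < q j) {lam : ℝ}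
    {ν : ℕ → ℝ} (hν : IsInvMeasure q lam ν) : GE ν (q 0) < ⊤ := by
  obtain ⟨j, hj, hqj⟩ := hpos
  have hs := (hν.2.2 j hj).1
  have hs1 := (summable_nat_add_iff 1).2 hs
  have : Summable (fun n => ν n * q 0 ^ n) := by
    rw [← summable_nat_add_iff 1]
    refine Summable.of_nonneg_of_le (fun i => mul_nonneg (hν.1 _) (pow_nonneg (hq0 0) _))
      (fun i => ?_) (hs1.mul_left (q 0 / q j))
    have h1 : q 0 ^ i * q j ≤ convPow q (i+1) j := by
      have := Finset.single_le_sum (f := fun k => convPow q i (j-k) * q k)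
        (fun k _ => mul_nonneg (convPow_nonneg hq0 i _) (hq0 k))
        (Finset.mem_range.2 (Nat.lt_succ_self j))
      simpa [convPow, convPow_zero_right] using this
    have h2 : ν (i+1) * q 0 ^ (i+1) = q 0 / q j * (ν (i+1) * (q 0 ^ i * q j)) := by
      field_simp; ring
    rw [h2]
    have := hν.1 (i+1); have := hq0 0
    gcongr
  unfold GE
  rw [← ENNReal.ofReal_tsum_of_nonneg (fun i => mul_nonneg (hν.1 _) (pow_nonneg (hq0 0) _)) this]
  exact ENNReal.ofReal_lt_top

lemma GE_mono {ν : ℕ → ℝ} (h : ∀ n, 0 ≤ ν n) {z w : ℝ} (hz : 0 ≤ z) (hzw : z ≤ w) :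
    GE ν z ≤ GE ν w :=
  ENNReal.tsum_le_tsum fun n => ENNReal.ofReal_le_ofReal
    (mul_le_mul_of_nonneg_left (pow_le_pow_left₀ hz hzw n) (h n))

lemma summable_of_GE {ν : ℕ → ℝ} (h : ∀ n, 0 ≤ ν n) {z : ℝ} (hz : 0 ≤ z) (hf : GE ν z ≠ ⊤) :
    Summable (fun n => ν n * z ^ n) := by
  have := ENNReal.summable_toReal hf
  refine this.congr fun n => ?_
  rw [ENNReal.toReal_ofReal (mul_nonneg (h n) (pow_nonneg hz n))]

lemma GE_eq {ν : ℕ → ℝ} (h : ∀ n, 0 ≤ ν n) {z : ℝ} (hz : 0 ≤ z)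
    (hf : Summable (fun n => ν n * z ^ n)) :
    GE ν z = ENNReal.ofReal (pgf ν z) :=
  (ENNReal.ofReal_tsum_of_nonneg (fun n => mul_nonneg (h n) (pow_nonneg hz n)) hf).symm

/-- basic one-step facts about the offspring generating function -/
structure Off (q : ℕ → ℝ) (m : ℝ) : Prop where
  q0 : ∀ k, 0 ≤ q k
  q1 : HasSum q 1
  hm : HasSum (fun k : ℕ => (k : ℝ) * q k) m
  m0 : 0 < m
  m1 : m < 1

namespace Off

lemma exists_pos {q : ℕ → ℝ} {m : ℝ} (h : Off q m) : ∃ j, 1 ≤ j ∧ 0 < q j := by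
  by_contra! hc
  have : (fun k : ℕ => (k : ℝ) * q k) = fun _ => 0 := by
    ext k
    rcases Nat.eq_zero_or_pos k with rfl | hk
    · simp
    · simp [le_antisymm (hc k hk) (h.q0 k)]
  have h1 := h.hm
  rw [this] at h1
  have := h1.unique hasSum_zero
  exact h.m0.ne' this

lemma q0_pos {q : ℕ → ℝ} {m : ℝ} (h : Off q m) : 0 < q 0 := by
  by_contra! hc
  have h0 := le_antisymm hc (h.q0 0)
  have : (1 : ℝ) ≤ m := hasSum_le (fun k => by
    rcases Nat.eq_zero_or_pos k with rfl | hk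
    · simp [h0]
    · have : (1 : ℝ) ≤ k := by exact_mod_cast hk
      exact le_mul_of_one_le_left (h.q0 k) this) h.q1 h.hm
  exact absurd h.m1 (not_lt.2 this)

lemma hasSum {q : ℕ → ℝ} {m : ℝ} (h : Off q m) {z : ℝ} (hz : z ∈ Icc (0 : ℝ) 1) : HasSum (fun k => q k * z ^ k) (pgf q z) :=
  (summable_pow h.q0 h.q1.summable hz).hasSum

lemma one_sub {q : ℕ → ℝ} {m : ℝ} (h : Off q m) {z : ℝ} (hz : z ∈ Icc (0 : ℝ) 1) :
    HasSum (fun k => q k * (1 - z ^ k)) (1 - pgf q z) := by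
  simpa [mul_sub] using h.q1.sub (h.hasSum hz)

lemma one_sub_le {q : ℕ → ℝ} {m : ℝ} (h : Off q m) {z : ℝ} (hz : z ∈ Icc (0 : ℝ) 1) : 1 - pgf q z ≤ m * (1 - z) := by
  refine hasSum_le (fun k => ?_) (h.one_sub hz) (h.hm.mul_right (1 - z))
  have hb := one_add_mul_le_pow (a := z - 1) (by linarith [hz.1]) k
  have : 1 - z ^ k ≤ k * (1 - z) := by
    have : (1 + (z - 1)) = z := by ring
    rw [this] at hb; linarith
  have := mul_le_mul_of_nonneg_left this (h.q0 k)
  linarith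

lemma mono {q : ℕ → ℝ} {m : ℝ} (h : Off q m) {z w : ℝ} (hz : 0 ≤ z) (hzw : z ≤ w) (hw : w ≤ 1) : pgf q z ≤ pgf q w :=
  hasSum_le (fun k => mul_le_mul_of_nonneg_left (pow_le_pow_left₀ hz hzw k) (h.q0 k))
    (h.hasSum ⟨hz, hzw.trans hw⟩) (h.hasSum ⟨hz.trans hzw, hw⟩)

lemma pgf_zero {q : ℕ → ℝ} {m : ℝ} (_ : Off q m) : pgf q 0 = q 0 := by
  unfold pgf
  rw [tsum_eq_single 0]
  · simp
  · intro b hb; simp [hb]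

lemma pgf_one {q : ℕ → ℝ} {m : ℝ} (h : Off q m) : pgf q 1 = 1 := by
  simp [pgf, h.q1.tsum_eq]

lemma maps {q : ℕ → ℝ} {m : ℝ} (h : Off q m) {z : ℝ} (hz : z ∈ Ico (0 : ℝ) 1) : pgf q z ∈ Ico (0 : ℝ) 1 := by
  refine ⟨pgf_nonneg h.q0 hz.1, ?_⟩
  obtain ⟨j, hj, hqj⟩ := h.exists_pos
  have : 0 < 1 - pgf q z := by
    rw [← (h.one_sub ⟨hz.1, hz.2.le⟩).tsum_eq]
    refine (h.one_sub ⟨hz.1, hz.2.le⟩).summable.tsum_pos (fun k => mul_nonneg (h.q0 k) ?_) j ?_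
    · exact sub_nonneg.2 (pow_le_one₀ hz.1 hz.2.le)
    · exact mul_pos hqj (sub_pos.2 (pow_lt_one₀ hz.1 hz.2 (by omega)))
  linarith

lemma maps_iter {q : ℕ → ℝ} {m : ℝ} (h : Off q m) {z : ℝ} (hz : z ∈ Ico (0 : ℝ) 1) (n : ℕ) : (pgf q)^[n] z ∈ Ico (0 : ℝ) 1 := by
  induction n with
  | zero => exact hz
  | succ n ih => rw [Function.iterate_succ_apply']; exact h.maps ih

lemma one_sub_iter_le {q : ℕ → ℝ} {m : ℝ} (h : Off q m) {z : ℝ} (hz : z ∈ Ico (0 : ℝ) 1) (n : ℕ) :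
    1 - (pgf q)^[n] z ≤ m ^ n := by
  induction n with
  | zero => simpa using hz.1
  | succ n ih =>
    rw [Function.iterate_succ_apply', pow_succ']
    have := h.maps_iter hz n
    exact (h.one_sub_le ⟨this.1, this.2.le⟩).trans (mul_le_mul_of_nonneg_left ih h.m0.le)

lemma iter_tendsto {q : ℕ → ℝ} {m : ℝ} (h : Off q m) {z : ℝ} (hz : z ∈ Ico (0 : ℝ) 1) :
    Tendsto (fun n => (pgf q)^[n] z) atTop (𝓝 1) := by
  have h1 : Tendsto (fun n => 1 - m ^ n) atTop (𝓝 1) := by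
    simpa using (tendsto_pow_atTop_nhds_zero_of_lt_one h.m0.le h.m1).const_sub 1
  exact tendsto_of_tendsto_of_tendsto_of_le_of_le h1 tendsto_const_nhds
    (fun n => by have := h.one_sub_iter_le hz n; simp only; linarith)
    (fun n => (h.maps_iter hz n).2.le)

lemma iter_mono {q : ℕ → ℝ} {m : ℝ} (h : Off q m) {z w : ℝ} (hz : 0 ≤ z) (hzw : z ≤ w) (hw : w < 1) (n : ℕ) :
    (pgf q)^[n] z ≤ (pgf q)^[n] w := by
  induction n with
  | zero => exact hzw
  | succ n ih =>
    simp only [Function.iterate_succ_apply']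
    exact h.mono (h.maps_iter ⟨hz, hzw.trans_lt hw⟩ n).1 ih
      (h.maps_iter ⟨hz.trans hzw, hw⟩ n).2.le

lemma iter_succ_pos {q : ℕ → ℝ} {m : ℝ} (h : Off q m) {z : ℝ} (hz : z ∈ Ico (0 : ℝ) 1) (n : ℕ) : 0 < (pgf q)^[n+1] z := by
  rw [Function.iterate_succ_apply']
  have h1 := h.maps_iter hz n
  refine h.q0_pos.trans_le ?_
  rw [← h.pgf_zero]
  exact h.mono le_rfl h1.1 h1.2.le

lemma GE_lt_top {q : ℕ → ℝ} {m : ℝ} (h : Off q m) {lam : ℝ} (hl : 0 ≤ lam) {ν : ℕ → ℝ} (hν : IsInvMeasure q lam ν) {z : ℝ}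
    (hz : z ∈ Ico (0 : ℝ) 1) : GE ν z < ⊤ := by
  have h0 := GE_q0_lt_top h.q0 h.exists_pos hν
  have hn : ∀ n, GE ν ((pgf q)^[n] 0) < ⊤ := by
    intro n
    induction n with
    | zero =>
      exact (GE_mono hν.1 le_rfl (h.q0 0)).trans_lt h0
    | succ n ih =>
      have h1 := h.maps_iter (z := 0) (by simp) n
      rw [Function.iterate_succ_apply', GE_func h.q0 h.q1.summable hl hν ⟨h1.1, h1.2.le⟩]
      exact ENNReal.add_lt_top.2 ⟨ENNReal.mul_lt_top ENNReal.ofReal_lt_top ih, h0⟩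
  obtain ⟨n, hn'⟩ := ((h.iter_tendsto (z := 0) (by simp)).eventually (lt_mem_nhds hz.2)).exists
  exact (GE_mono hν.1 hz.1 hn'.le).trans_lt (hn n)

lemma inv_summable {q : ℕ → ℝ} {m : ℝ} (h : Off q m) {lam : ℝ} (hl : 0 ≤ lam) {ν : ℕ → ℝ} (hν : IsInvMeasure q lam ν) {z : ℝ}
    (hz : z ∈ Ico (0 : ℝ) 1) : Summable (fun n => ν n * z ^ n) :=
  summable_of_GE hν.1 hz.1 (h.GE_lt_top hl hν hz).ne

lemma q0_lt {q : ℕ → ℝ} {m : ℝ} (h : Off q m) : q 0 ∈ Ico (0:ℝ) 1 := by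
  have := h.maps (z := 0) (by simp)
  rwa [h.pgf_zero] at this

lemma inv_func {q : ℕ → ℝ} {m : ℝ} (h : Off q m) {lam : ℝ} (hl : 0 ≤ lam) {ν : ℕ → ℝ} (hν : IsInvMeasure q lam ν) {z : ℝ}
    (hz : z ∈ Ico (0 : ℝ) 1) : pgf ν (pgf q z) = lam * pgf ν z + pgf ν (q 0) := by
  have := GE_func h.q0 h.q1.summable hl hν ⟨hz.1, hz.2.le⟩
  rw [GE_eq hν.1 (h.maps hz).1 (h.inv_summable hl hν (h.maps hz)),
    GE_eq hν.1 hz.1 (h.inv_summable hl hν hz), GE_eq hν.1 h.q0_lt.1 (h.inv_summable hl hν h.q0_lt),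
    ← ENNReal.ofReal_mul hl, ← ENNReal.ofReal_add (mul_nonneg hl (pgf_nonneg hν.1 hz.1))
      (pgf_nonneg hν.1 h.q0_lt.1)] at this
  rwa [ENNReal.ofReal_eq_ofReal_iff (pgf_nonneg hν.1 (h.maps hz).1)] at this
  exact add_nonneg (mul_nonneg hl (pgf_nonneg hν.1 hz.1)) (pgf_nonneg hν.1 h.q0_lt.1)

lemma inv_iter {q : ℕ → ℝ} {m : ℝ} (h : Off q m) {lam : ℝ} (hl : 0 ≤ lam) {ν : ℕ → ℝ} (hν : IsInvMeasure q lam ν) {z : ℝ}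
    (hz : z ∈ Ico (0 : ℝ) 1) (n : ℕ) :
    pgf ν ((pgf q)^[n] z) - pgf ν ((pgf q)^[n] 0) = lam ^ n * pgf ν z := by
  induction n with
  | zero =>
    have : pgf ν 0 = 0 := by
      unfold pgf
      rw [tsum_eq_single 0]
      · simp [hν.2.1]
      · intro b hb; simp [hb]
    simp [this]
  | succ n ih =>
    simp only [Function.iterate_succ_apply']
    rw [h.inv_func hl hν (h.maps_iter hz n), h.inv_func hl hν (h.maps_iter (by simp) n)]
    rw [pow_succ]
    linear_combination lam * ih

end Off

end BGW

namespace BGW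

lemma geom_aux (w : ℝ) (k : ℕ) : 1 - w ^ k = (1 - w) * ∑ i ∈ Finset.range k, w ^ i := by
  rw [mul_neg_geom_sum]

/-- a probability on the positive integers -/
structure Pr (p : ℕ → ℝ) : Prop where
  p0 : ∀ k, 0 ≤ p k
  z0 : p 0 = 0
  p1 : HasSum p 1

namespace Pr

lemma hasSum {p : ℕ → ℝ} (h : Pr p) {z : ℝ} (hz : z ∈ Icc (0 : ℝ) 1) :
    HasSum (fun k => p k * z ^ k) (pgf p z) :=
  (summable_pow h.p0 h.p1.summable hz).hasSum

lemma one_sub {p : ℕ → ℝ} (h : Pr p) {z : ℝ} (hz : z ∈ Icc (0 : ℝ) 1) :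
    HasSum (fun k => p k * (1 - z ^ k)) (1 - pgf p z) := by
  simpa [mul_sub] using h.p1.sub (h.hasSum hz)

lemma one_sub_ge {p : ℕ → ℝ} (h : Pr p) {z : ℝ} (hz : z ∈ Icc (0 : ℝ) 1) :
    1 - z ≤ 1 - pgf p z := by
  have h1 : HasSum (fun k => p k * (1 - z)) (1 - z) := by simpa using h.p1.mul_right (1 - z)
  refine hasSum_le (fun k => ?_) h1 (h.one_sub hz)
  rcases Nat.eq_zero_or_pos k with rfl | hk
  · simp [h.z0]
  · refine mul_le_mul_of_nonneg_left ?_ (h.p0 k)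
    have := pow_le_of_le_one hz.1 hz.2 (n := k) (by omega)
    linarith

lemma cross {p : ℕ → ℝ} (h : Pr p) {w w' : ℝ} (hw' : 0 ≤ w') (hle : w' ≤ w) (hw : w ≤ 1) :
    (1 - pgf p w') * (1 - w) ≤ (1 - pgf p w) * (1 - w') := by
  refine hasSum_le (fun k => ?_) ((h.one_sub ⟨hw', hle.trans hw⟩).mul_right (1 - w))
    ((h.one_sub ⟨hw'.trans hle, hw⟩).mul_right (1 - w'))
  rw [mul_assoc, mul_assoc]
  refine mul_le_mul_of_nonneg_left ?_ (h.p0 k)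
  rw [geom_aux w, geom_aux w']
  have : ∑ i ∈ Finset.range k, w' ^ i ≤ ∑ i ∈ Finset.range k, w ^ i :=
    Finset.sum_le_sum fun i _ => pow_le_pow_left₀ hw' hle i
  have h2 : 0 ≤ (1 - w) * (1 - w') := mul_nonneg (by linarith) (by linarith)
  nlinarith [mul_le_mul_of_nonneg_left this h2]

lemma pgf_zero {p : ℕ → ℝ} (h : Pr p) : pgf p 0 = 0 := by
  unfold pgf
  rw [tsum_eq_single 0]
  · simp [h.z0]
  · intro b hb; simp [hb]

lemma pgf_one {p : ℕ → ℝ} (h : Pr p) : pgf p 1 = 1 := by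
  simp [pgf, h.p1.tsum_eq]

lemma lt_one {p : ℕ → ℝ} (h : Pr p) {z : ℝ} (hz : z ∈ Ico (0 : ℝ) 1) : pgf p z < 1 := by
  have := h.one_sub_ge ⟨hz.1, hz.2.le⟩
  have := hz.2
  linarith

lemma continuousOn {p : ℕ → ℝ} (h : Pr p) : ContinuousOn (pgf p) (Icc 0 1) := by
  unfold pgf
  refine continuousOn_tsum (u := p) (fun n => by fun_prop) h.p1.summable fun n x hx => ?_
  rw [norm_of_nonneg (mul_nonneg (h.p0 n) (pow_nonneg hx.1 n))]
  exact mul_le_of_le_one_right (h.p0 n) (pow_le_one₀ hx.1 hx.2)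

lemma strictMono {p : ℕ → ℝ} (h : Pr p) : StrictMonoOn (pgf p) (Icc 0 1) := by
  intro a ha b hb hab
  obtain ⟨j, hj⟩ : ∃ j, p j ≠ 0 := by
    by_contra! hc
    have h1 := h.p1
    rw [show p = fun _ => 0 from funext hc] at h1
    exact one_ne_zero (h1.unique hasSum_zero)
  have hj0 : j ≠ 0 := fun h' => hj (h' ▸ h.z0)
  have hjp := lt_of_le_of_ne (h.p0 j) hj.symm
  refine (h.hasSum ha).summable.tsum_lt_tsum (i := j) (fun k => ?_) ?_ (h.hasSum hb).summable
  · exact mul_le_mul_of_nonneg_left (pow_le_pow_left₀ ha.1 hab.le k) (h.p0 k)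
  · exact mul_lt_mul_of_pos_left (pow_lt_pow_left₀ hab ha.1 hj0) hjp

lemma exists_eq {p : ℕ → ℝ} (h : Pr p) {y : ℝ} (hy : y ∈ Ioo (0 : ℝ) 1) :
    ∃ z ∈ Ioo (0 : ℝ) 1, 1 - pgf p z = y := by
  have := intermediate_value_Ioo zero_le_one h.continuousOn
  rw [h.pgf_zero, h.pgf_one] at this
  obtain ⟨z, hz, he⟩ := this (show 1 - y ∈ Ioo (0 : ℝ) 1 from ⟨by linarith [hy.2], by linarith [hy.1]⟩)
  exact ⟨z, hz, by linarith⟩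

lemma pos {p : ℕ → ℝ} (h : Pr p) {z : ℝ} (hz : z ∈ Ioo (0 : ℝ) 1) : 0 < pgf p z := by
  have := h.strictMono (a := 0) (by simp) ⟨hz.1.le, hz.2.le⟩ hz.1
  rwa [h.pgf_zero] at this

end Pr

namespace Off

lemma H_func {q : ℕ → ℝ} {m : ℝ} (h : Off q m) {p : ℕ → ℝ} (hp : Pr p)
    (hi : IsInvMeasure q m p) : pgf p (q 0) = 1 - m ∧
    ∀ z ∈ Ico (0 : ℝ) 1, 1 - pgf p (pgf q z) = m * (1 - pgf p z) := by
  have h1 := GE_func h.q0 h.q1.summable h.m0.le hi (z := 1) (by simp)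
  have hs : Summable (fun n => p n * (1 : ℝ) ^ n) := by simpa using hp.p1.summable
  rw [h.pgf_one, GE_eq hp.p0 zero_le_one hs, hp.pgf_one,
    GE_eq hp.p0 h.q0_lt.1 (h.inv_summable h.m0.le hi h.q0_lt), ← ENNReal.ofReal_mul h.m0.le,
    mul_one, ← ENNReal.ofReal_add h.m0.le (pgf_nonneg hp.p0 h.q0_lt.1),
    ENNReal.ofReal_eq_ofReal_iff zero_le_one
      (add_nonneg h.m0.le (pgf_nonneg hp.p0 h.q0_lt.1))] at h1
  refine ⟨by linarith, fun z hz => ?_⟩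
  rw [h.inv_func h.m0.le hi hz]
  linear_combination h1

lemma H_iter {q : ℕ → ℝ} {m : ℝ} (h : Off q m) {p : ℕ → ℝ} (hp : Pr p)
    (hi : IsInvMeasure q m p) {z : ℝ} (hz : z ∈ Ico (0 : ℝ) 1) (n : ℕ) :
    1 - pgf p ((pgf q)^[n] z) = m ^ n * (1 - pgf p z) := by
  induction n with
  | zero => simp
  | succ n ih =>
    rw [Function.iterate_succ_apply', (h.H_func hp hi).2 _ (h.maps_iter hz n), ih]
    ring

lemma Q_tendsto {q : ℕ → ℝ} {m : ℝ} (h : Off q m) {u : ℕ → ℝ} (hu : ∀ n, u n ∈ Ico (0 : ℝ) 1)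
    (hl : Tendsto u atTop (𝓝 1)) :
    Tendsto (fun n => (1 - pgf q (u n)) / (1 - u n)) atTop (𝓝 m) := by
  have e : ∀ n, (1 - pgf q (u n)) / (1 - u n) =
      ∑' k, q k * ∑ i ∈ Finset.range k, u n ^ i := by
    intro n
    have h0 : 1 - u n ≠ 0 := (sub_pos.2 (hu n).2).ne'
    rw [← ((h.one_sub ⟨(hu n).1, (hu n).2.le⟩).div_const (1 - u n)).tsum_eq]
    congr 1; ext k
    rw [geom_aux]; field_simp
  simp_rw [e]
  rw [← h.hm.tsum_eq]
  refine tendsto_tsum_of_dominated_convergence (bound := fun k => (k : ℝ) * q k) h.hm.summable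
    (fun k => ?_) (Eventually.of_forall fun n k => ?_)
  · have : Tendsto (fun n => q k * ∑ i ∈ Finset.range k, u n ^ i) atTop
        (𝓝 (q k * ∑ i ∈ Finset.range k, (1 : ℝ) ^ i)) :=
      (tendsto_finsetSum _ fun i _ => hl.pow i).const_mul _
    simpa [mul_comm] using this
  · have h1 : 0 ≤ ∑ i ∈ Finset.range k, u n ^ i :=
      Finset.sum_nonneg fun i _ => pow_nonneg (hu n).1 i
    rw [norm_of_nonneg (mul_nonneg (h.q0 k) h1), mul_comm]
    refine mul_le_mul_of_nonneg_right ?_ (h.q0 k)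
    calc _ ≤ ∑ i ∈ Finset.range k, (1 : ℝ) :=
          Finset.sum_le_sum fun i _ => pow_le_one₀ (hu n).1 (hu n).2.le
      _ = k := by simp

lemma ratio_tendsto {q : ℕ → ℝ} {m : ℝ} (h : Off q m) {p : ℕ → ℝ} (hp : Pr p)
    (hi : IsInvMeasure q m p) {z : ℝ} (hz : z ∈ Ico (0 : ℝ) 1) :
    Tendsto (fun n => (1 - (pgf q)^[n] z) / (1 - (pgf q)^[n] 0)) atTop (𝓝 (1 - pgf p z)) := by
  have z0 : (0 : ℝ) ∈ Ico (0 : ℝ) 1 := by simp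
  set D : ℕ → ℝ := fun n => m ^ n / (1 - (pgf q)^[n] 0) with hD
  have pos0 : ∀ n, 0 < 1 - (pgf q)^[n] 0 := fun n => sub_pos.2 (h.maps_iter z0 n).2
  have posz : ∀ n, 0 < 1 - (pgf q)^[n] z := fun n => sub_pos.2 (h.maps_iter hz n).2
  have mpos : ∀ n, 0 < m ^ n := fun n => pow_pos h.m0 n
  have Dpos : ∀ n, 0 < D n := fun n => div_pos (mpos n) (pos0 n)
  have D1 : Tendsto (fun n => D n / D (n+1)) atTop (𝓝 1) := by
    have := (h.Q_tendsto (h.maps_iter z0) (h.iter_tendsto z0)).div_const m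
    rw [div_self h.m0.ne'] at this
    refine this.congr fun n => ?_
    simp only [hD, Function.iterate_succ_apply', pow_succ]
    have := (pos0 n).ne'
    have h3 := (pos0 (n+1)).ne'
    rw [Function.iterate_succ_apply'] at h3
    have := (mpos n).ne'
    have := h.m0.ne'
    field_simp
  have Dk : ∀ k, Tendsto (fun n => D n / D (n+k)) atTop (𝓝 1) := by
    intro k
    induction k with
    | zero => 
      refine tendsto_const_nhds.congr fun n => ?_
      simp [(Dpos n).ne']
    | succ k ih =>
      have := ih.mul (D1.comp (tendsto_add_atTop_nat k))
      rw [one_mul] at this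
      refine this.congr fun n => ?_
      have := (Dpos (n+k)).ne'
      simp only [Function.comp]
      rw [div_mul_div_cancel₀ this]; rfl
  obtain ⟨k, hk⟩ := ((h.iter_tendsto z0).eventually (lt_mem_nhds hz.2)).exists
  have Hz : 0 < 1 - pgf p z := sub_pos.2 (hp.lt_one hz)
  have H0 : ∀ n, 1 - pgf p ((pgf q)^[n] 0) = m ^ n := fun n => by
    rw [h.H_iter hp hi z0, hp.pgf_zero]; ring
  refine tendsto_of_tendsto_of_tendsto_of_le_of_le (by simpa using (Dk k).const_mul (1 - pgf p z))
    tendsto_const_nhds (fun n => ?_) (fun n => ?_)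
  · have hle : (pgf q)^[n] z ≤ (pgf q)^[n+k] 0 := by
      rw [Function.iterate_add_apply]
      exact h.iter_mono hz.1 hk.le (h.maps_iter z0 k).2 n
    have c := hp.cross (h.maps_iter hz n).1 hle (h.maps_iter z0 (n+k)).2.le
    rw [H0, h.H_iter hp hi hz] at c
    simp only [hD]
    rw [div_div_div_eq, le_div_iff₀ (pos0 n)]
    have := (pos0 n).ne'
    have := mpos (n+k)
    have e : (1 - pgf p z) * (m ^ n * (1 - (pgf q)^[n + k] 0) / ((1 - (pgf q)^[n] 0) * m ^ (n + k)))
       * (1 - (pgf q)^[n] 0) = m ^ n * (1 - pgf p z) * (1 - (pgf q)^[n + k] 0) / m ^ (n+k) := by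
      field_simp
    rw [e, div_le_iff₀ this]
    linarith
  · have hle := h.iter_mono le_rfl hz.1 hz.2 n
    have c := hp.cross (h.maps_iter z0 n).1 hle (h.maps_iter hz n).2.le
    rw [H0, h.H_iter hp hi hz] at c
    simp only
    rw [div_le_iff₀ (pos0 n)]
    have := mpos n
    rw [mul_assoc] at c
    exact le_of_mul_le_mul_left c this

lemma log_aux {u : ℕ → ℝ} (hu : ∀ n, u n ∈ Ico (0 : ℝ) 1) (hl : Tendsto u atTop (𝓝 1)) :
    Tendsto (fun n => -Real.log (u n) / (1 - u n)) atTop (𝓝 1) := by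
  have hd : HasDerivAt Real.log 1 1 := by simpa using Real.hasDerivAt_log one_ne_zero
  have := hasDerivAt_iff_tendsto_slope.1 hd
  have hu' : Tendsto u atTop (𝓝[≠] 1) :=
    tendsto_nhdsWithin_iff.2 ⟨hl, Eventually.of_forall fun n => (hu n).2.ne⟩
  refine (this.comp hu').congr fun n => ?_
  simp only [Function.comp, slope_def_field, Real.log_one, sub_zero]
  rw [← neg_div_neg_eq, neg_sub]

lemma logratio_tendsto {q : ℕ → ℝ} {m : ℝ} (h : Off q m) {p : ℕ → ℝ} (hp : Pr p)
    (hi : IsInvMeasure q m p) {z : ℝ} (hz : z ∈ Ico (0 : ℝ) 1) :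
    Tendsto (fun n => Real.log ((pgf q)^[n] z) / Real.log ((pgf q)^[n] 0)) atTop
      (𝓝 (1 - pgf p z)) := by
  have z0 : (0 : ℝ) ∈ Ico (0 : ℝ) 1 := by simp
  have a := log_aux (h.maps_iter hz) (h.iter_tendsto hz)
  have b := log_aux (h.maps_iter z0) (h.iter_tendsto z0)
  have := (a.div b one_ne_zero).mul (h.ratio_tendsto hp hi hz)
  rw [div_one, one_mul] at this
  refine this.congr fun n => ?_
  have pos0 : 0 < 1 - (pgf q)^[n] 0 := sub_pos.2 (h.maps_iter z0 n).2
  have posz : 0 < 1 - (pgf q)^[n] z := sub_pos.2 (h.maps_iter hz n).2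
  simp only [Pi.div_apply]
  rw [div_div_div_eq, div_mul_div_comm]
  have : -Real.log ((pgf q)^[n] z) * (1 - (pgf q)^[n] 0) * (1 - (pgf q)^[n] z) /
      ((1 - (pgf q)^[n] z) * -Real.log ((pgf q)^[n] 0) * (1 - (pgf q)^[n] 0)) =
      (-Real.log ((pgf q)^[n] z)) * ((1 - (pgf q)^[n] 0) * (1 - (pgf q)^[n] z)) /
      ((-Real.log ((pgf q)^[n] 0)) * ((1 - (pgf q)^[n] 0) * (1 - (pgf q)^[n] z))) := by
    congr 1 <;> ring
  rw [this, mul_div_mul_right _ _ (mul_pos pos0 posz).ne', neg_div_neg_eq]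

end Off

end BGW

namespace BGW

/-- the kernel `(e^{-ax} - e^{-bx})/x` -/
noncomputable def K (a b x : ℝ) : ℝ := ∫ s in a..b, Real.exp (-(s * x))

lemma K_cont (a b : ℝ) : Continuous (K a b) := by
  unfold K
  apply intervalIntegral.continuous_parametric_intervalIntegral_of_continuous'
  simp only [Function.uncurry_def]
  fun_prop

lemma K_int (a b x : ℝ) : IntervalIntegrable (fun s => Real.exp (-(s * x))) volume a b :=
  Continuous.intervalIntegrable (by fun_prop) a b

lemma K_mul (a b x : ℝ) : x * K a b x = Real.exp (-(a * x)) - Real.exp (-(b * x)) := by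
  have h : ∀ s ∈ uIcc a b, HasDerivAt (fun s => -Real.exp (-(s * x))) (x * Real.exp (-(s * x))) s := by
    intro s _
    have := (((hasDerivAt_id s).mul_const x).neg).exp.neg
    refine this.congr_deriv ?_
    simp only [id, Pi.neg_apply]
    ring
  unfold K
  rw [← intervalIntegral.integral_const_mul,
    intervalIntegral.integral_eq_sub_of_hasDerivAt h ((K_int a b x).const_mul x)]
  ring

lemma K_add (a b c x : ℝ) : K a b x + K b c x = K a c x :=
  intervalIntegral.integral_add_adjacent_intervals (K_int a b x) (K_int b c x)

lemma K_scale (m a b x : ℝ) : K (m * a) (m * b) x = m * K a b (m * x) := by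
  unfold K
  have := intervalIntegral.smul_integral_comp_mul_left (a := a) (b := b)
    (fun s => Real.exp (-(s * x))) m
  rw [← this, smul_eq_mul]
  congr 2; ext s; congr 2; ring

lemma K_shift (a b c x : ℝ) : K (a + c) (b + c) x = Real.exp (-(c * x)) * K a b x := by
  unfold K
  rw [← intervalIntegral.integral_comp_add_right (fun s => Real.exp (-(s * x))),
    ← intervalIntegral.integral_const_mul]
  congr 1; ext s
  rw [← Real.exp_add]; congr 1; ring

lemma K_nonneg {a b : ℝ} (h : a ≤ b) (x : ℝ) : 0 ≤ K a b x :=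
  intervalIntegral.integral_nonneg h fun _ _ => (Real.exp_pos _).le

lemma K_pos {a b : ℝ} (h : a < b) (x : ℝ) : 0 < K a b x :=
  intervalIntegral.intervalIntegral_pos_of_pos (K_int a b x) (fun _ => Real.exp_pos _) h

lemma K_abs_le {a b x : ℝ} (ha : 0 ≤ a) (hb : 0 ≤ b) (hx : 0 ≤ x) : |K a b x| ≤ |b - a| := by
  have := intervalIntegral.norm_integral_le_of_norm_le_const (a := a) (b := b) (C := 1)
    (f := fun s => Real.exp (-(s * x))) (fun s hs => by
      rw [Real.norm_of_nonneg (Real.exp_pos _).le]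
      apply Real.exp_le_one_iff.2
      have : 0 ≤ s := by
        rw [mem_uIoc] at hs
        rcases hs with hs | hs <;> linarith
      have := mul_nonneg this hx
      linarith)
  simpa [K] using this

/-- truncated kernel as a bounded continuous function -/
noncomputable def Kb (a b : ℝ) (ha : 0 ≤ a) (hb : 0 ≤ b) : BoundedContinuousFunction ℝ ℝ :=
  BoundedContinuousFunction.ofNormedAddCommGroup (fun x => K a b (max x 0))
    ((K_cont a b).comp (by fun_prop)) |b - a|
    (fun _ => K_abs_le ha hb (le_max_right _ _))

lemma atom_bound {y0 p p' r x R : ℝ} (hp : p < p') (hp' : p' < y0) (hy0 : y0 < 1)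
    (hr : r ≤ p) (hx : 0 ≤ x) (hR : R ≤ x) :
    x * Real.exp (-(y0 * x)) ≤ Real.exp (-((y0 - p') * R)) * (p' - p)⁻¹ *
      (Real.exp (-(r * x)) - Real.exp (-x)) := by
  have h1 : (p' - p) * (x * Real.exp (-(p' * x))) ≤ Real.exp (-(r * x)) - Real.exp (-x) := by
    have h2 : Real.exp (-(p * x)) ≤ Real.exp (-(r * x)) := by
      apply Real.exp_le_exp.2; nlinarith
    have h3 : Real.exp (-x) ≤ Real.exp (-(p' * x)) := by
      apply Real.exp_le_exp.2; nlinarith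
    have h4 : (p' - p) * (x * Real.exp (-(p' * x))) ≤
        Real.exp (-(p * x)) - Real.exp (-(p' * x)) := by
      have := Real.add_one_le_exp ((p' - p) * x)
      have e : Real.exp (-(p * x)) = Real.exp ((p' - p) * x) * Real.exp (-(p' * x)) := by
        rw [← Real.exp_add]; congr 1; ring
      rw [e]
      nlinarith [Real.exp_pos (-(p' * x))]
    linarith
  have h5 : Real.exp (-(y0 * x)) ≤ Real.exp (-((y0 - p') * R)) * Real.exp (-(p' * x)) := by
    rw [← Real.exp_add]; apply Real.exp_le_exp.2; nlinarith
  have h6 : 0 < p' - p := by linarith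
  calc x * Real.exp (-(y0 * x)) ≤ x * (Real.exp (-((y0 - p') * R)) * Real.exp (-(p' * x))) := by
        gcongr
    _ = Real.exp (-((y0 - p') * R)) * (p' - p)⁻¹ * ((p' - p) * (x * Real.exp (-(p' * x)))) := by
        field_simp
    _ ≤ _ := by gcongr

noncomputable def etaM (w : ℕ → ℝ) (t y0 : ℝ) : Measure ℝ :=
  Measure.sum fun k : ℕ =>
    ENNReal.ofReal (w k * (k * t * Real.exp (-(y0 * (k * t))))) • Measure.dirac (k * t)

lemma lintegral_etaM (w : ℕ → ℝ) (t y0 : ℝ) (f : ℝ → ℝ≥0∞) (hf : Measurable f) :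
    ∫⁻ x, f x ∂(etaM w t y0) =
      ∑' k : ℕ, ENNReal.ofReal (w k * (k * t * Real.exp (-(y0 * (k * t))))) * f (k * t) := by
  unfold etaM
  rw [lintegral_sum_measure]
  congr 1; ext k
  rw [lintegral_smul_measure, lintegral_dirac' _ hf, smul_eq_mul]

lemma etaM_bound {w : ℕ → ℝ} (hw : ∀ k, 0 ≤ w k) {t : ℝ} (ht : 0 < t) {y0 p p' r R G : ℝ}
    (hp : p < p') (hp' : p' < y0) (hy0 : y0 < 1) (hr : r ≤ p)
    (hsum : HasSum (fun k : ℕ => w k * (Real.exp (-(r * (k * t))) - Real.exp (-(k * t)))) G)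
    (A : Set ℝ) (hA : MeasurableSet A) (hAR : ∀ x, 0 ≤ x → x ∈ A → R ≤ x) :
    etaM w t y0 A ≤ ENNReal.ofReal (Real.exp (-((y0 - p') * R)) * (p' - p)⁻¹ * G) := by
  have h0 : ∀ k : ℕ, 0 ≤ w k * (Real.exp (-(r * (k * t))) - Real.exp (-(k * t))) := by
    intro k
    refine mul_nonneg (hw k) (sub_nonneg.2 (Real.exp_le_exp.2 ?_))
    have : 0 ≤ (k : ℝ) * t := by positivity
    nlinarith
  have hpp : 0 < p' - p := by linarith
  have hs2 := hsum.mul_left (Real.exp (-((y0 - p') * R)) * (p' - p)⁻¹)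
  rw [← lintegral_indicator_one hA, lintegral_etaM _ _ _ _ (measurable_one.indicator hA),
    ← hs2.tsum_eq, ENNReal.ofReal_tsum_of_nonneg (fun k => mul_nonneg (by positivity) (h0 k))
      hs2.summable]
  refine ENNReal.tsum_le_tsum fun k => ?_
  by_cases hk : (k * t : ℝ) ∈ A
  · simp only [indicator_of_mem hk, Pi.one_apply, mul_one]
    apply ENNReal.ofReal_le_ofReal
    have hx : (0 : ℝ) ≤ k * t := by positivity
    have := mul_le_mul_of_nonneg_left (atom_bound hp hp' hy0 hr hx (hAR _ hx hk)) (hw k)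
    refine this.trans (le_of_eq ?_)
    ring
  · simp [indicator_of_notMem hk]

lemma integral_etaM {w : ℕ → ℝ} (hw : ∀ k, 0 ≤ w k) {t : ℝ} (ht : 0 < t) {y0 r G : ℝ}
    (hr : y0 ≤ r) (hr1 : r ≤ 1)  (h1 : 0 ≤ r - y0) (h2 : 0 ≤ 1 - y0)
    (hsum : HasSum (fun k : ℕ => w k * (Real.exp (-(r * (k * t))) - Real.exp (-(k * t)))) G) :
    ∫ x, Kb (r - y0) (1 - y0) h1 h2 x ∂(etaM w t y0) = G := by
  have hle : r - y0 ≤ 1 - y0 := by linarith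
  have hn : ∀ x, 0 ≤ Kb (r - y0) (1 - y0) h1 h2 x := fun x => K_nonneg hle _
  have h0 : ∀ k : ℕ, 0 ≤ w k * (Real.exp (-(r * (k * t))) - Real.exp (-(k * t))) := by
    intro k
    refine mul_nonneg (hw k) (sub_nonneg.2 (Real.exp_le_exp.2 ?_))
    have : 0 ≤ (k : ℝ) * t := by positivity
    nlinarith
  rw [integral_eq_lintegral_of_nonneg_ae (Eventually.of_forall hn)
    (Kb (r - y0) (1 - y0) h1 h2).continuous.aestronglyMeasurable, lintegral_etaM]
  · have : ∀ k : ℕ, ENNReal.ofReal (w k * (k * t * Real.exp (-(y0 * (k * t))))) *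
        ENNReal.ofReal (Kb (r - y0) (1 - y0) h1 h2 (k * t)) =
        ENNReal.ofReal (w k * (Real.exp (-(r * (k * t))) - Real.exp (-(k * t)))) := by
      intro k
      have hx : (0 : ℝ) ≤ k * t := by positivity
      have hw := hw k
      rw [← ENNReal.ofReal_mul (by positivity)]
      congr 1
      change _ * K (r - y0) (1 - y0) (max (k * t) 0) = _
      rw [max_eq_left hx]
      have e1 := K_shift (r - y0) (1 - y0) y0 (k * t)
      have e2 := K_mul r 1 (k * t)
      simp only [sub_add_cancel] at e1
      rw [e1, one_mul] at e2
      rw [← e2]; ring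
    simp_rw [this]
    rw [← ENNReal.ofReal_tsum_of_nonneg h0 hsum.summable, hsum.tsum_eq, ENNReal.toReal_ofReal]
    rw [← hsum.tsum_eq]; exact tsum_nonneg h0
  · exact ((Kb (r - y0) (1 - y0) h1 h2).continuous.measurable).ennreal_ofReal

lemma core_limit (w : ℕ → ℕ → ℝ) (hw : ∀ n k, 0 ≤ w n k) (t : ℕ → ℝ) (ht : ∀ n, 0 < t n)
    (r : ℕ → ℝ → ℝ) (y G : ℝ → ℝ)
    (hsum : ∀ z ∈ Ioo (0 : ℝ) 1, ∀ n, HasSum (fun k : ℕ =>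
      w n k * (Real.exp (-(r n z * (k * t n))) - Real.exp (-(k * t n)))) (G z))
    (hr : ∀ z ∈ Ioo (0 : ℝ) 1, Tendsto (fun n => r n z) atTop (𝓝 (y z)))
    (y0 : ℝ) (hy01 : y0 < 1) (z1 : ℝ) (hz1 : z1 ∈ Ioo (0 : ℝ) 1)
    (hz1' : y z1 < y0) :
    ∃ η : Measure ℝ, IsFiniteMeasure η ∧ η (Iio 0) = 0 ∧ ∀ z ∈ Ioo (0 : ℝ) 1,
      y0 < y z → y z < 1 → G z = ∫ x, K (y z - y0) (1 - y0) x ∂η := by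
  obtain ⟨p, hp1, hp2⟩ := exists_between hz1'
  obtain ⟨p', hp3, hp4⟩ := exists_between hp2
  obtain ⟨N, hN⟩ := eventually_atTop.1 ((hr z1 hz1).eventually (gt_mem_nhds hp1))
  set C : ℝ := (p' - p)⁻¹ * G z1 with hC
  have b1 : ∀ n R, ∀ A : Set ℝ, MeasurableSet A → (∀ x, 0 ≤ x → x ∈ A → R ≤ x) →
      etaM (w (n+N)) (t (n+N)) y0 A ≤ ENNReal.ofReal (Real.exp (-((y0 - p') * R)) * C) := by
    intro n R A hA hAR
    have := etaM_bound (hw (n+N)) (ht (n+N)) hp3 hp4 hy01 (hN (n+N) (by omega)).le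
      (hsum z1 hz1 (n+N)) A hA hAR
    rwa [mul_assoc] at this
  have b2 : ∀ n, etaM (w (n+N)) (t (n+N)) y0 univ ≤ ENNReal.ofReal C := by
    intro n
    have := b1 n 0 univ MeasurableSet.univ (fun x hx _ => hx)
    simpa using this
  have fin : ∀ n, IsFiniteMeasure (etaM (w (n+N)) (t (n+N)) y0) := fun n =>
    ⟨(b2 n).trans_lt ENNReal.ofReal_lt_top⟩
  let ηf : ℕ → FiniteMeasure ℝ := fun n => ⟨etaM (w (n+N)) (t (n+N)) y0, fin n⟩
  let u : ℕ → ℝ≥0 := fun n => (Real.exp (-((y0 - p') * n)) * C).toNNReal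
  have hu : Tendsto u atTop (𝓝 0) := by
    have h1 : Tendsto (fun n : ℕ => (y0 - p') * (n : ℝ)) atTop atTop :=
      tendsto_natCast_atTop_atTop.const_mul_atTop (by linarith)
    have h2 := (Real.tendsto_exp_neg_atTop_nhds_zero.comp h1).mul_const C
    rw [zero_mul] at h2
    have h3 := (continuous_real_toNNReal.tendsto 0).comp h2
    rw [Real.toNNReal_zero] at h3
    exact h3
  have hcomp := isCompact_setOfPred_finiteMeasure_mass_le_compl_isCompact_le (E := ℝ) (u := u)
    (K := fun n : ℕ => Icc (0 : ℝ) n) C.toNNReal hu (fun n => isCompact_Icc)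
    (Or.inl inferInstance)
  have hmem : ∀ n, ηf n ∈ {μ : FiniteMeasure ℝ | μ.mass ≤ C.toNNReal ∧
      ∀ n : ℕ, μ (Icc (0 : ℝ) n)ᶜ ≤ u n} := by
    intro n
    constructor
    · rw [← ENNReal.coe_le_coe, FiniteMeasure.ennreal_mass]
      exact b2 n
    · intro R
      rw [← ENNReal.coe_le_coe, FiniteMeasure.ennreal_coeFn_eq_coeFn_toMeasure]
      refine b1 n R _ measurableSet_Icc.compl fun x hx hxA => ?_
      by_contra! hlt
      exact hxA ⟨hx, hlt.le⟩
  obtain ⟨η, hηS, hη⟩ := isCompact_iff_ultrafilter_le_nhds'.1 hcomp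
    ((hyperfilter ℕ).map ηf) (Filter.mem_map.2 (Filter.univ_mem' hmem))
  have hη' : Tendsto ηf (hyperfilter ℕ) (𝓝 η) := hη
  have hneg : (η : Measure ℝ) (Iio 0) = 0 := by
    have hle : ∀ n, η (Iio 0) ≤ u n := fun n => by
      have hsub : Iio (0 : ℝ) ⊆ (Icc (0 : ℝ) n)ᶜ := fun x hx hx' => absurd hx'.1 (not_le.2 hx)
      exact (FiniteMeasure.apply_mono η hsub).trans (hηS.2 n)
    have : η (Iio 0) = 0 := le_antisymm (ge_of_tendsto' hu hle) zero_le
    rw [← FiniteMeasure.ennreal_coeFn_eq_coeFn_toMeasure, this]; rfl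
  refine ⟨η, inferInstance, hneg, fun z hz hyz hyz1 => ?_⟩
  have hyp : NeBot (hyperfilter ℕ : Filter ℕ) := inferInstance
  have hle : (hyperfilter ℕ : Filter ℕ) ≤ atTop := Nat.hyperfilter_le_atTop
  have h1 : 0 ≤ y z - y0 := by linarith
  have h2 : 0 ≤ 1 - y0 := by linarith
  have hae : ∫ x, K (y z - y0) (1 - y0) x ∂(η : Measure ℝ) =
      ∫ x, Kb (y z - y0) (1 - y0) h1 h2 x ∂(η : Measure ℝ) := by
    apply integral_congr_ae
    have : ∀ᵐ x ∂(η : Measure ℝ), x ∉ Iio (0 : ℝ) := measure_eq_zero_iff_ae_notMem.1 hneg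
    filter_upwards [this] with x hx
    change _ = K _ _ (max x 0)
    rw [max_eq_left (by simpa using hx)]
  rw [hae]
  have L1 := (FiniteMeasure.tendsto_iff_forall_integral_tendsto.1 hη')
    (Kb (y z - y0) (1 - y0) h1 h2)
  have hrz : Tendsto (fun n => r (n+N) z) atTop (𝓝 (y z)) :=
    (hr z hz).comp (tendsto_add_atTop_nat N)
  have L2 : Tendsto (fun n => G z - ∫ x, Kb (y z - y0) (1 - y0) h1 h2 x ∂(ηf n : Measure ℝ))
      atTop (𝓝 0) := by
    refine squeeze_zero_norm' (a := fun n => |r (n+N) z - y z| * C.toNNReal) ?_ ?_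
    · filter_upwards [hrz.eventually (lt_mem_nhds hyz), hrz.eventually (gt_mem_nhds hyz1)]
        with n hn1 hn2
      have h3 : 0 ≤ r (n+N) z - y0 := by linarith
      have e := integral_etaM (hw (n+N)) (ht (n+N)) hn1.le hn2.le h3 h2 (hsum z hz (n+N))
      have := fin n
      have hi1 := (Kb (r (n+N) z - y0) (1 - y0) h3 h2).integrable (etaM (w (n+N)) (t (n+N)) y0)
      have hi2 := (Kb (y z - y0) (1 - y0) h1 h2).integrable (etaM (w (n+N)) (t (n+N)) y0)
      rw [← e]
      change ‖_ - ∫ x, Kb (y z - y0) (1 - y0) h1 h2 x ∂(etaM (w (n+N)) (t (n+N)) y0)‖ ≤ _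
      rw [← integral_sub hi1 hi2]
      refine (norm_integral_le_of_norm_le_const (C := |r (n+N) z - y z|)
        (Eventually.of_forall fun x => ?_)).trans ?_
      · change ‖K (r (n+N) z - y0) (1 - y0) (max x 0) - K (y z - y0) (1 - y0) (max x 0)‖ ≤ _
        rw [← K_add (r (n+N) z - y0) (y z - y0) (1 - y0), add_sub_cancel_right, abs_sub_comm]
        have := K_abs_le h3 h1 (le_max_right x 0)
        rw [Real.norm_eq_abs]
        refine this.trans (le_of_eq ?_)
        congr 1; ring
      · refine mul_le_mul_of_nonneg_left ?_ (abs_nonneg _)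
        have := ENNReal.toReal_mono ENNReal.coe_ne_top (b2 n)
        exact this
    · have := ((hrz.sub_const (y z)).abs).mul_const (C.toNNReal : ℝ)
      simpa using this
  have L3 := (L2.mono_left hle).add L1
  simp only [sub_add_cancel, zero_add] at L3
  exact tendsto_nhds_unique tendsto_const_nhds L3

end BGW

namespace BGW

lemma ext_mgf (τ₁ τ₂ : Measure ℝ) [IsFiniteMeasure τ₁] [IsFiniteMeasure τ₂] (d : ℝ) (hd : 0 < d)
    (h : ∀ t ∈ Ioo (-d) d, ∫⁻ x, ENNReal.ofReal (Real.exp (t * x)) ∂τ₁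
      = ∫⁻ x, ENNReal.ofReal (Real.exp (t * x)) ∂τ₂)
    (hf : ∀ t ∈ Ioo (-d) d, ∫⁻ x, ENNReal.ofReal (Real.exp (t * x)) ∂τ₁ ≠ ⊤) : τ₁ = τ₂ := by
  have hint : ∀ τ : Measure ℝ, (∀ t ∈ Ioo (-d) d, ∫⁻ x, ENNReal.ofReal (Real.exp (t * x)) ∂τ ≠ ⊤) →
      Ioo (-d) d ⊆ interior (ProbabilityTheory.integrableExpSet id τ) := by
    intro τ hτ
    apply interior_maximal _ isOpen_Ioo
    intro t ht
    change Integrable (fun x : ℝ => Real.exp (t * id x)) τ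
    refine ⟨by fun_prop, ?_⟩
    rw [hasFiniteIntegral_iff_ofReal (Filter.Eventually.of_forall fun x => (Real.exp_pos _).le)]
    exact lt_top_iff_ne_top.2 (hτ t ht)
  have hi1 := hint τ₁ hf
  have hi2 := hint τ₂ (fun t ht => h t ht ▸ hf t ht)
  have hS : ∀ τ : Measure ℝ, Ioo (-d) d ⊆ interior (ProbabilityTheory.integrableExpSet id τ) →
      AnalyticOnNhd ℂ (ProbabilityTheory.complexMGF id τ) {z : ℂ | z.re ∈ Ioo (-d) d} := by
    intro τ hτ
    exact ProbabilityTheory.analyticOnNhd_complexMGF.mono fun z hz => hτ hz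
  have hEq : Set.EqOn (ProbabilityTheory.complexMGF id τ₁) (ProbabilityTheory.complexMGF id τ₂)
      {z : ℂ | z.re ∈ Ioo (-d) d} := by
    refine AnalyticOnNhd.eqOn_of_preconnected_of_frequently_eq (hS τ₁ hi1) (hS τ₂ hi2)
      ((convex_Ioo (-d) d).linear_preimage Complex.reLm).isPreconnected
      (z₀ := ((0:ℝ) : ℂ)) (by simp [hd]) ?_
    have h_real : ∃ᶠ (x : ℝ) in 𝓝[≠] 0, ProbabilityTheory.complexMGF id τ₁ x
        = ProbabilityTheory.complexMGF id τ₂ x := by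
      apply Filter.Eventually.frequently
      have : Ioo (-d) d ∈ 𝓝 (0:ℝ) := Ioo_mem_nhds (by linarith) hd
      filter_upwards [mem_nhdsWithin_of_mem_nhds this] with t ht
      rw [ProbabilityTheory.complexMGF_ofReal, ProbabilityTheory.complexMGF_ofReal]
      congr 1
      simp only [ProbabilityTheory.mgf, id]
      rw [integral_eq_lintegral_of_nonneg_ae (Filter.Eventually.of_forall fun x => (Real.exp_pos _).le)
        (by fun_prop), integral_eq_lintegral_of_nonneg_ae
        (Filter.Eventually.of_forall fun x => (Real.exp_pos _).le) (by fun_prop), h t ht]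
    rw [frequently_iff_seq_forall] at h_real ⊢
    obtain ⟨xs, hx_tendsto, hx_eq⟩ := h_real
    refine ⟨fun n ↦ xs n, ?_, fun n ↦ ?_⟩
    · rw [tendsto_nhdsWithin_iff] at hx_tendsto ⊢
      constructor
      · rw [tendsto_ofReal_iff]
        exact hx_tendsto.1
      · simpa using hx_tendsto.2
    · simp [hx_eq]
  apply Measure.ext_of_charFun
  ext t
  rw [← ProbabilityTheory.complexMGF_id_mul_I, ← ProbabilityTheory.complexMGF_id_mul_I]
  exact hEq (by simp [hd])

/-- integrated kernel -/
noncomputable def JJ (σ : Measure ℝ) (a b : ℝ) : ℝ≥0∞ := ∫⁻ x, ENNReal.ofReal (K a b x) ∂σ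

lemma K_meas (a b : ℝ) : Measurable fun x => ENNReal.ofReal (K a b x) :=
  ENNReal.measurable_ofReal.comp (K_cont a b).measurable

lemma JJ_add (σ : Measure ℝ) {a b c : ℝ} (hab : a ≤ b) (hbc : b ≤ c) :
    JJ σ a b + JJ σ b c = JJ σ a c := by
  unfold JJ
  rw [← lintegral_add_left (K_meas a b)]
  congr 1
  ext x
  rw [← ENNReal.ofReal_add (K_nonneg hab x) (K_nonneg hbc x), K_add]

lemma JJ_scale (σ : Measure ℝ) {m : ℝ} (hm : 0 < m) (a b : ℝ) :
    JJ σ (m * a) (m * b) = ENNReal.ofReal m * JJ (σ.map (fun x => m * x)) a b := by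
  unfold JJ
  rw [lintegral_map (K_meas a b) (by fun_prop), ← lintegral_const_mul' _ _ ENNReal.ofReal_ne_top]
  congr 1
  ext x
  rw [K_scale, ENNReal.ofReal_mul hm.le]

lemma JJ_smul (σ : Measure ℝ) (c : ℝ≥0∞) (a b : ℝ) : JJ (c • σ) a b = c * JJ σ a b := by
  unfold JJ
  rw [lintegral_smul_measure, smul_eq_mul]

lemma JJ_shift (σ : Measure ℝ) (a b c : ℝ) : JJ σ (a + c) (b + c) =
    ∫⁻ x, ENNReal.ofReal (Real.exp (-c * x)) ∂(σ.withDensity fun x => ENNReal.ofReal (K a b x)) := by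
  unfold JJ
  rw [lintegral_withDensity_eq_lintegral_mul _ (K_meas a b) (by fun_prop)]
  congr 1
  ext x
  rw [Pi.mul_apply, K_shift, ENNReal.ofReal_mul (Real.exp_pos _).le, mul_comm, neg_mul]

lemma scaling (σ : Measure ℝ) {m : ℝ} (hm : 0 < m) (hm1 : m < 1) (a : ℝ)
    (hfin : ∀ y ∈ Ioo (m / 4) 1, JJ σ y 1 ≠ ⊤)
    (hf : ∀ y ∈ Ioo (1 / 4 : ℝ) 1, JJ σ (m * y) 1 = ENNReal.ofReal a * JJ σ y 1 + JJ σ m 1) :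
    ENNReal.ofReal m • σ.map (fun x => m * x) = ENNReal.ofReal a • σ := by
  set σ₁ := ENNReal.ofReal m • σ.map (fun x => m * x) with hσ₁
  set σ₂ := ENNReal.ofReal a • σ with hσ₂
  have h1 : ∀ y ∈ Ioo (1 / 4 : ℝ) 1, JJ σ₁ y 1 = JJ σ₂ y 1 := by
    intro y hy
    rw [hσ₁, hσ₂, JJ_smul, JJ_smul, ← JJ_scale σ hm, mul_one]
    have := hf y hy
    rw [← JJ_add σ (show m * y ≤ m by nlinarith [hy.2]) hm1.le] at this
    exact (ENNReal.add_left_inj (hfin m ⟨by linarith, hm1⟩)).1 this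
  have h1f : ∀ y ∈ Ioo (1 / 4 : ℝ) 1, JJ σ₂ y 1 ≠ ⊤ := by
    intro y hy
    rw [hσ₂, JJ_smul]
    exact ENNReal.mul_ne_top ENNReal.ofReal_ne_top (hfin y ⟨by linarith [hy.1], hy.2⟩)
  have h2 : ∀ y ∈ Ioo (1 / 4 : ℝ) (3 / 4), JJ σ₁ y (y + 1 / 4) = JJ σ₂ y (y + 1 / 4)
      ∧ JJ σ₁ y (y + 1 / 4) ≠ ⊤ := by
    intro y hy
    have hy1 : y ∈ Ioo (1 / 4 : ℝ) 1 := ⟨hy.1, by linarith [hy.2]⟩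
    have hy2 : y + 1 / 4 ∈ Ioo (1 / 4 : ℝ) 1 := ⟨by linarith [hy.1], by linarith [hy.2]⟩
    have e := h1 y hy1
    rw [← JJ_add σ₁ (show y ≤ y + 1 / 4 by linarith) hy2.2.le,
      ← JJ_add σ₂ (show y ≤ y + 1 / 4 by linarith) hy2.2.le, h1 _ hy2] at e
    have e' := (ENNReal.add_left_inj (h1f _ hy2)).1 e
    refine ⟨e', ?_⟩
    rw [e']
    refine ne_top_of_le_ne_top (h1f y hy1) ?_
    rw [← JJ_add σ₂ (show y ≤ y + 1 / 4 by linarith) hy2.2.le]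
    exact le_self_add
  have h3 : ∀ t ∈ Ioo (-(1/4) : ℝ) (1 / 4), ∀ τ : Measure ℝ, ∫⁻ x, ENNReal.ofReal (Real.exp (t * x))
      ∂(τ.withDensity fun x => ENNReal.ofReal (K (1/2) (3/4) x)) =
      JJ τ (1 / 2 - t) (1 / 2 - t + 1 / 4) := by
    intro t ht τ
    have := JJ_shift τ (1/2) (3/4) (-t)
    rw [neg_neg] at this
    rw [← this]
    congr 1
    ring
  have h2' : ∀ t ∈ Ioo (-(1/4) : ℝ) (1 / 4), _ := fun t ht =>
    h2 (1 / 2 - t) ⟨by linarith [ht.2], by linarith [ht.1]⟩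
  have hfinm : ∀ τ : Measure ℝ, JJ τ (1/2) (3/4) ≠ ⊤ →
      IsFiniteMeasure (τ.withDensity fun x => ENNReal.ofReal (K (1/2) (3/4) x)) :=
    fun τ h => isFiniteMeasure_withDensity h
  have h20 := h2 (1/2) ⟨by norm_num, by norm_num⟩
  rw [show (1/2 + 1/4 : ℝ) = 3/4 by norm_num] at h20
  have := hfinm σ₁ h20.2
  have := hfinm σ₂ (h20.1 ▸ h20.2)
  have key := ext_mgf (σ₁.withDensity fun x => ENNReal.ofReal (K (1/2) (3/4) x))
    (σ₂.withDensity fun x => ENNReal.ofReal (K (1/2) (3/4) x)) (1/4) (by norm_num)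
    (fun t ht => by rw [h3 t ht, h3 t ht]; exact (h2' t ht).1)
    (fun t ht => by rw [h3 t ht]; exact (h2' t ht).2)
  have hne : ∀ τ : Measure ℝ, (τ.withDensity fun x => ENNReal.ofReal (K (1/2) (3/4) x)).withDensity
      (fun x => ENNReal.ofReal (K (1/2) (3/4) x))⁻¹ = τ := fun τ =>
    withDensity_inv_same (K_meas _ _)
      (Filter.Eventually.of_forall fun x => by
        simpa using K_pos (show (1/2:ℝ) < 3/4 by norm_num) x)
      (Filter.Eventually.of_forall fun x => ENNReal.ofReal_ne_top)
  rw [← hne σ₁, key, hne]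

end BGW

namespace BGW

lemma JJ_withDensity (η : Measure ℝ) [IsFiniteMeasure η] (hη : η (Iio 0) = 0) (y0 y : ℝ)
    (h0 : y0 < y) (h1 : y < 1) (g : ℝ) (hg : g = ∫ x, K (y - y0) (1 - y0) x ∂η) :
    ENNReal.ofReal g = JJ (η.withDensity fun x => ENNReal.ofReal (Real.exp (y0 * x))) y 1 := by
  have hae : ∀ᵐ x ∂η, 0 ≤ x := by
    rw [ae_iff]
    convert hη using 2
    ext x; simp
  have hint : Integrable (fun x => K (y - y0) (1 - y0) x) η := by
    refine Integrable.of_bound (K_cont _ _).aestronglyMeasurable |1 - y0 - (y - y0)| ?_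
    filter_upwards [hae] with x hx
    exact K_abs_le (by linarith) (by linarith) hx
  rw [hg, ofReal_integral_eq_lintegral_ofReal hint
    (Filter.Eventually.of_forall fun x => K_nonneg (by linarith) x)]
  unfold JJ
  rw [lintegral_withDensity_eq_lintegral_mul _ (by fun_prop) (K_meas y 1)]
  congr 1
  ext x
  rw [Pi.mul_apply, ← ENNReal.ofReal_mul (Real.exp_pos _).le]
  congr 1
  have := K_shift (y - y0) (1 - y0) y0 x
  rw [sub_add_cancel, sub_add_cancel] at this
  rw [this, ← mul_assoc, ← Real.exp_add]
  simp

lemma locfin_wd (η : Measure ℝ) [IsFiniteMeasure η] (y0 : ℝ) :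
    ∀ C : Set ℝ, IsCompact C → ∀ f : ℝ → ℝ, ContinuousOn f C →
      ∫⁻ x in C, ENNReal.ofReal (f x) ∂(η.withDensity fun x => ENNReal.ofReal (Real.exp (y0 * x))) < ⊤ := by
  intro C hC f hf
  have hloc : IsLocallyFiniteMeasure (η.withDensity fun x => ENNReal.ofReal (Real.exp (y0 * x))) :=
    IsLocallyFiniteMeasure.withDensity_ofReal (by fun_prop)
  exact (hf.integrableOn_compact hC).lintegral_lt_top

lemma final_measure (σ : Measure ℝ) (hneg : σ (Iio 0) = 0)
    (hloc : ∀ C : Set ℝ, IsCompact C → ∀ f : ℝ → ℝ, ContinuousOn f C →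
      ∫⁻ x in C, ENNReal.ofReal (f x) ∂σ < ⊤)
    {m α : ℝ} (hm : 0 < m) (hm1 : m < 1) (hα : α < 1)
    (hs : ENNReal.ofReal m • σ.map (fun x => m * x) = ENNReal.ofReal (m ^ α) • σ) :
    ∃ Λ : Measure ℝ, IsLocFiniteOnPos Λ ∧ ScaleInvariant m Λ ∧
      ∀ y ∈ Ioo (0:ℝ) 1, ∫ x in Ioi (0:ℝ), (Real.exp (-(y * x)) - Real.exp (-x)) * x ^ (-α) ∂Λ
        = (JJ σ y 1).toReal := by
  have hmul : Measurable fun x : ℝ => m * x := by fun_prop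
  have hma : m < m ^ α := by
    conv_lhs => rw [← Real.rpow_one m]
    exact Real.rpow_lt_rpow_of_exponent_gt hm hm1 hα
  have hapos : 0 < m ^ α := Real.rpow_pos_of_pos hm _
  have h00 : σ {0} = 0 := by
    have h1 : (ENNReal.ofReal m • σ.map (fun x => m * x)) {0} = (ENNReal.ofReal (m ^ α) • σ) {0} := by
      rw [hs]
    rw [Measure.smul_apply, Measure.smul_apply, Measure.map_apply hmul (measurableSet_singleton 0),
      smul_eq_mul, smul_eq_mul] at h1
    have h2 : (fun x : ℝ => m * x) ⁻¹' {0} = {0} := by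
      ext x; simp [hm.ne']
    rw [h2] at h1
    by_contra hne
    have hfin : σ {0} ≠ ⊤ := by
      have := hloc {0} isCompact_singleton (fun _ => 1) continuousOn_const
      simpa using this.ne
    have h3 := (ENNReal.mul_left_inj hne hfin).1 h1
    rw [ENNReal.ofReal_eq_ofReal_iff hm.le hapos.le] at h3
    linarith
  have hIic : σ (Iic 0) = 0 := by
    rw [← Iio_union_right]
    exact measure_union_null hneg h00
  have hres : σ.restrict (Ioi 0) = σ := by
    apply Measure.restrict_eq_self_of_ae_mem
    rw [ae_iff]
    convert hIic using 2
    ext x; simp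
  have hdm : Measurable fun x : ℝ => ENNReal.ofReal (x ^ (α - 1)) := by fun_prop
  refine ⟨σ.withDensity fun x => ENNReal.ofReal (x ^ (α - 1)), ⟨?_, ?_⟩, ?_, ?_⟩
  · exact withDensity_absolutelyContinuous _ _ hIic
  · intro C hC hsub
    rw [withDensity_apply _ hC.measurableSet]
    refine hloc C hC _ ?_
    intro x hx
    exact (Real.continuousAt_rpow_const x _ (Or.inl (ne_of_gt (hsub hx)))).continuousWithinAt
  · intro A hA hsub
    have hAm : MeasurableSet ((fun x => m * x) '' A) := by
      have : (fun x => m * x) '' A = (fun x => m⁻¹ * x) ⁻¹' A := by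
        ext x
        simp only [mem_image, mem_preimage]
        constructor
        · rintro ⟨u, hu, rfl⟩
          rwa [inv_mul_cancel_left₀ hm.ne']
        · intro hx
          exact ⟨_, hx, mul_inv_cancel_left₀ hm.ne' x⟩
      rw [this]
      exact (measurable_const_mul _) hA
    have hpre : (fun x => m * x) ⁻¹' ((fun x => m * x) '' A) = A :=
      preimage_image_eq _ (mul_right_injective₀ hm.ne')
    rw [withDensity_apply _ hA, withDensity_apply _ hAm]
    have e1 : ∫⁻ x in (fun x => m * x) '' A, ENNReal.ofReal (x ^ (α - 1))
          ∂(ENNReal.ofReal m • σ.map (fun x => m * x)) =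
        ∫⁻ x in (fun x => m * x) '' A, ENNReal.ofReal (x ^ (α - 1)) ∂(ENNReal.ofReal (m ^ α) • σ) := by
      rw [hs]
    rw [Measure.restrict_smul, Measure.restrict_smul, lintegral_smul_measure,
      lintegral_smul_measure, setLIntegral_map hAm hdm hmul, hpre, smul_eq_mul, smul_eq_mul] at e1
    have e2 : ∫⁻ x in A, ENNReal.ofReal ((m * x) ^ (α - 1)) ∂σ =
        ENNReal.ofReal (m ^ (α - 1)) * ∫⁻ x in A, ENNReal.ofReal (x ^ (α - 1)) ∂σ := by
      rw [← lintegral_const_mul' _ _ ENNReal.ofReal_ne_top]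
      apply setLIntegral_congr_fun hA
      intro x hx
      have hx0 : 0 < x := hsub hx
      simp only
      rw [Real.mul_rpow hm.le hx0.le, ENNReal.ofReal_mul (Real.rpow_nonneg hm.le _)]
    rw [e2, ← mul_assoc, ← ENNReal.ofReal_mul hm.le] at e1
    have e3 : m * m ^ (α - 1) = m ^ α := by
      rw [Real.rpow_sub_one hm.ne']; field_simp
    rw [e3] at e1
    exact (ENNReal.mul_right_inj (by simpa using hapos) ENNReal.ofReal_ne_top).1 e1
  · intro y hy
    have hfm : Measurable fun x : ℝ => (Real.exp (-(y * x)) - Real.exp (-x)) * x ^ (-α) := by fun_prop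
    rw [integral_eq_lintegral_of_nonneg_ae _ hfm.aestronglyMeasurable]
    · congr 1
      rw [restrict_withDensity measurableSet_Ioi, hres,
        lintegral_withDensity_eq_lintegral_mul _ hdm hfm.ennreal_ofReal]
      unfold JJ
      rw [← hres]
      apply setLIntegral_congr_fun measurableSet_Ioi
      intro x hx
      have hx0 : 0 < x := hx
      simp only [Pi.mul_apply]
      rw [← ENNReal.ofReal_mul (Real.rpow_nonneg hx0.le _)]
      congr 1
      have hk := K_mul y 1 x
      rw [one_mul] at hk
      rw [← hk, show α - 1 = α + (-1) by ring, Real.rpow_add hx0, Real.rpow_neg hx0.le α,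
        Real.rpow_neg_one]
      have := (Real.rpow_pos_of_pos hx0 α).ne'
      field_simp
    · rw [EventuallyLE, ae_restrict_iff' measurableSet_Ioi]
      refine Filter.Eventually.of_forall fun x hx => ?_
      have hx0 : 0 < x := hx
      refine mul_nonneg (sub_nonneg.2 (Real.exp_le_exp.2 ?_)) (Real.rpow_nonneg hx0.le _)
      nlinarith [hy.2]

end BGW

namespace BGW

lemma Off.main {q : ℕ → ℝ} {m : ℝ} (h : Off q m) {p : ℕ → ℝ} (hp : Pr p)
    (hi : IsInvMeasure q m p) {α : ℝ} (hα : α < 1) {ν : ℕ → ℝ} (hν : IsInvMeasure q (m ^ α) ν) :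
    ∃ Λ : Measure ℝ, IsLocFiniteOnPos Λ ∧ ScaleInvariant m Λ ∧
      ∀ z ∈ Set.Ioo (0 : ℝ) 1, pgf ν z = ∫ x in Set.Ioi (0 : ℝ),
            (Real.exp (-((1 - pgf p z) * x)) - Real.exp (-x)) * x ^ (-α) ∂Λ := by
  have m0 := h.m0
  have m1 := h.m1
  have ha : 0 < m ^ α := Real.rpow_pos_of_pos m0 _
  have z00 : (0:ℝ) ∈ Ico (0:ℝ) 1 := ⟨le_rfl, one_pos⟩
  obtain ⟨z1, hz1, hz1'⟩ := hp.exists_eq (y := m / 8) ⟨by linarith, by linarith⟩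
  have iterpos : ∀ z ∈ Ico (0:ℝ) 1, ∀ n, 0 < (pgf q)^[n + 1] z := fun z hz n => h.iter_succ_pos hz n
  have tpos : ∀ n, 0 < -Real.log ((pgf q)^[n + 1] 0) := by
    intro n
    exact neg_pos.2 (Real.log_neg (iterpos 0 z00 n) (h.maps_iter z00 (n+1)).2)
  have hpow : ∀ x : ℝ, 0 < x → ∀ k : ℕ, x ^ k = Real.exp (k * Real.log x) := by
    intro x hx k
    rw [mul_comm, Real.exp_mul, Real.exp_log hx, Real.rpow_natCast]
  obtain ⟨η, hηf, hη0, hη⟩ := core_limit (fun n k => ((m ^ α) ^ (n + 1))⁻¹ * ν k)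
    (fun n k => mul_nonneg (by positivity) (hν.1 k))
    (fun n => -Real.log ((pgf q)^[n + 1] 0)) tpos
    (fun n z => Real.log ((pgf q)^[n + 1] z) / Real.log ((pgf q)^[n + 1] 0))
    (fun z => 1 - pgf p z) (pgf ν)
    (by
      intro z hz n
      have hz' : z ∈ Ico (0:ℝ) 1 := ⟨hz.1.le, hz.2⟩
      have s1 := (h.inv_summable ha.le hν (h.maps_iter hz' (n+1))).hasSum
      have s2 := (h.inv_summable ha.le hν (h.maps_iter z00 (n+1))).hasSum
      have s3 := (s1.sub s2).mul_left (((m ^ α) ^ (n + 1))⁻¹)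
      have e := h.inv_iter ha.le hν hz' (n+1)
      change HasSum _ (((m ^ α) ^ (n + 1))⁻¹ *
        (pgf ν ((pgf q)^[n + 1] z) - pgf ν ((pgf q)^[n + 1] 0))) at s3
      rw [e, inv_mul_cancel_left₀ (by positivity)] at s3
      refine (congrArg (fun F : ℕ → ℝ => HasSum F (pgf ν z)) (funext fun k => ?_)).mpr s3
      have hl := (tpos n).ne'
      have hl' : Real.log ((pgf q)^[n + 1] 0) ≠ 0 := neg_ne_zero.1 hl
      change _ = ((m ^ α) ^ (n + 1))⁻¹ * (ν k * ((pgf q)^[n + 1] z) ^ k - ν k * ((pgf q)^[n + 1] 0) ^ k)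
      rw [hpow _ (iterpos z hz' n), hpow _ (iterpos 0 z00 n), ← mul_sub, mul_assoc]
      congr 3
      · congr 1
        change -(Real.log ((pgf q)^[n + 1] z) / Real.log ((pgf q)^[n + 1] 0) *
          (k * -Real.log ((pgf q)^[n + 1] 0))) = _
        field_simp
      · congr 1
        change -(k * -Real.log ((pgf q)^[n + 1] 0)) = _
        ring)
    (by
      intro z hz
      exact (h.logratio_tendsto hp hi ⟨hz.1.le, hz.2⟩).comp (tendsto_add_atTop_nat 1))
    (m / 4) (by linarith) z1 hz1 (by linarith)
  set σ := η.withDensity (fun x => ENNReal.ofReal (Real.exp (m / 4 * x))) with hσ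
  have hJ : ∀ z ∈ Ioo (0:ℝ) 1, m / 4 < 1 - pgf p z → ENNReal.ofReal (pgf ν z) = JJ σ (1 - pgf p z) 1 := by
    intro z hz hlt
    have hlt1 : 1 - pgf p z < 1 := by linarith [hp.pos hz]
    exact JJ_withDensity η hη0 _ _ hlt hlt1 _ (hη z hz hlt hlt1)
  obtain ⟨hHq, hH⟩ := h.H_func hp hi
  have hq0 : q 0 ∈ Ioo (0:ℝ) 1 := ⟨h.q0_pos, h.q0_lt.2⟩
  have hJm : ENNReal.ofReal (pgf ν (q 0)) = JJ σ m 1 := by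
    have := hJ (q 0) hq0 (by rw [hHq]; linarith)
    rwa [hHq, sub_sub_cancel] at this
  have hfpos : ∀ z ∈ Ioo (0:ℝ) 1, pgf q z ∈ Ioo (0:ℝ) 1 := fun z hz =>
    ⟨iterpos z ⟨hz.1.le, hz.2⟩ 0, (h.maps ⟨hz.1.le, hz.2⟩).2⟩
  have hG : ∀ z ∈ Ioo (0:ℝ) 1, ENNReal.ofReal (pgf ν (pgf q z)) =
      ENNReal.ofReal (m ^ α) * ENNReal.ofReal (pgf ν z) + JJ σ m 1 := by
    intro z hz
    rw [h.inv_func ha.le hν ⟨hz.1.le, hz.2⟩, ENNReal.ofReal_add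
      (mul_nonneg ha.le (pgf_nonneg hν.1 hz.1.le)) (pgf_nonneg hν.1 hq0.1.le),
      ENNReal.ofReal_mul ha.le, hJm]
  have hscale := scaling σ m0 m1 (m ^ α)
    (by
      intro y hy
      obtain ⟨z, hz, rfl⟩ := hp.exists_eq (y := y) ⟨by linarith [hy.1], hy.2⟩
      rw [← hJ z hz hy.1]
      exact ENNReal.ofReal_ne_top)
    (by
      intro y hy
      obtain ⟨z, hz, rfl⟩ := hp.exists_eq (y := y) ⟨by linarith [hy.1], hy.2⟩
      have e := hH z ⟨hz.1.le, hz.2⟩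
      rw [← hJ z hz (by linarith [hy.1]), ← e, ← hJ _ (hfpos z hz) (by rw [e]; nlinarith [hy.1]),
        hG z hz])
  have hJf : ∀ y ≤ (1:ℝ), JJ σ (m * y) 1 = ENNReal.ofReal (m ^ α) * JJ σ y 1 + JJ σ m 1 := by
    intro y hy
    rw [← JJ_add σ (show m * y ≤ m by nlinarith) m1.le]
    have := JJ_scale σ m0 y 1
    rw [mul_one, ← JJ_smul, hscale, JJ_smul] at this
    rw [this]
  have hall : ∀ n : ℕ, ∀ z ∈ Ioo (0:ℝ) 1, m / 4 * m ^ n < 1 - pgf p z →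
      ENNReal.ofReal (pgf ν z) = JJ σ (1 - pgf p z) 1 := by
    intro n
    induction n with
    | zero => intro z hz hlt; exact hJ z hz (by simpa using hlt)
    | succ n ih =>
      intro z hz hlt
      by_cases hc : m / 4 < 1 - pgf p z
      · exact hJ z hz hc
      push Not at hc
      have hyp : 0 < 1 - pgf p z := by linarith [hp.lt_one ⟨hz.1.le, hz.2⟩]
      obtain ⟨z', hz', he⟩ := hp.exists_eq (y := (1 - pgf p z) / m)
        ⟨by positivity, by rw [div_lt_one m0]; linarith⟩
      have he' : m * (1 - pgf p z') = 1 - pgf p z := by rw [he]; field_simp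
      have hfz := hH z' ⟨hz'.1.le, hz'.2⟩
      have hzz : pgf q z' = z := by
        refine hp.strictMono.injOn (Ioo_subset_Icc_self (hfpos z' hz')) (Ioo_subset_Icc_self hz) ?_
        linarith
      have := hG z' hz'
      rw [hzz, ih z' hz' (by rw [he, lt_div_iff₀ m0]; calc
        m / 4 * m ^ n * m = m / 4 * m ^ (n+1) := by ring
        _ < _ := hlt)] at this
      rw [this, ← he', hJf _ (by linarith [hp.pos hz'])]
  obtain ⟨Λ, hΛ1, hΛ2, hΛ3⟩ := final_measure σ
    (withDensity_absolutelyContinuous _ _ hη0) (locfin_wd η (m / 4)) m0 m1 hα hscale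
  refine ⟨Λ, hΛ1, hΛ2, fun z hz => ?_⟩
  have hyp : 0 < 1 - pgf p z := by linarith [hp.lt_one ⟨hz.1.le, hz.2⟩]
  rw [hΛ3 _ ⟨hyp, by linarith [hp.pos hz]⟩]
  obtain ⟨n, hn⟩ := exists_pow_lt_of_lt_one hyp m1
  rw [← hall n z hz (by nlinarith [pow_pos m0 n]), ENNReal.toReal_ofReal (pgf_nonneg hν.1 hz.1.le)]

end BGW

theorem invariant_measure_integral_representation
    (q : ℕ → ℝ) (hq0 : ∀ k, 0 ≤ q k) (hq1 : HasSum q 1)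
    (m : ℝ) (hm : HasSum (fun k : ℕ => (k : ℝ) * q k) m) (hm0 : 0 < m) (hm1 : m < 1)
    (νmin : ℕ → ℝ) (hmin : IsInvMeasure q m νmin) (hmin1 : HasSum νmin 1)
    (α : ℝ) (hα : α < 1)
    (ν : ℕ → ℝ) (hν : IsInvMeasure q (m ^ α) ν) :
    (∀ z ∈ Set.Ico (0 : ℝ) 1, Summable fun n => ν n * z ^ n) ∧
    ∃ Λ : Measure ℝ, IsLocFiniteOnPos Λ ∧ ScaleInvariant m Λ ∧
      ∀ z ∈ Set.Ioo (0 : ℝ) 1,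
        ∑' n, ν n * z ^ n =
          ∫ x in Set.Ioi (0 : ℝ),
            (Real.exp (((∑' n, νmin n * z ^ n) - 1) * x) - Real.exp (-x)) * x ^ (-α) ∂Λ := by
  have h : BGW.Off q m := ⟨hq0, hq1, hm, hm0, hm1⟩
  have hp : BGW.Pr νmin := ⟨hmin.1, hmin.2.1, hmin1⟩
  refine ⟨fun z hz => h.inv_summable (Real.rpow_nonneg hm0.le _) hν hz, ?_⟩
  obtain ⟨Λ, h1, h2, h3⟩ := h.main hp hmin hα hν
  refine ⟨Λ, h1, h2, fun z hz => ?_⟩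
  refine (h3 z hz).trans ?_
  have : ∀ x : ℝ, ((∑' n, νmin n * z ^ n) - 1) * x = -((1 - BGW.pgf νmin z) * x) := by
    intro x
    unfold BGW.pgf
    ring
  simp only [this]
end

section
/- Let m ∈ (0,1), α < 1, and let Λ₁ and Λ₂ be locally finite Borel measures on (0,∞) each satisfying Λᵢ(A) = Λᵢ(mA) for every Borel set A ⊆ (0,∞) (i = 1,2). If for every h ∈ (0,1) the integrals ∫₀^∞ (e^{(h−1)x} − e^{−x})·x^{−α} Λ₁(dx) and ∫₀^∞ (e^{(h−1)x} − e^{−x})·x^{−α} Λ₂(dx) are finite and equal, then Λ₁ = Λ₂. (In other words, the measure Λ in the integral representation of a λ-invariant measure is uniquely determined.) -/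
open MeasureTheory Real Set

open ProbabilityTheory in
lemma ext_of_mgf_near_zero (μ ν : Measure ℝ) [IsFiniteMeasure μ] [IsFiniteMeasure ν] (c : ℝ)
    (hc : 0 < c)
    (h : ∀ t ∈ Ioo (-c) c, Integrable (fun x => Real.exp (t * x)) μ ∧
      Integrable (fun x => Real.exp (t * x)) ν ∧
      ∫ x, Real.exp (t * x) ∂μ = ∫ x, Real.exp (t * x) ∂ν) : μ = ν := by
  have hsub (ρ : Measure ℝ) (hρ : ∀ t ∈ Ioo (-c) c, Integrable (fun x => Real.exp (t * x)) ρ) :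
      AnalyticOnNhd ℂ (complexMGF id ρ) {z : ℂ | z.re ∈ Ioo (-c) c} := by
    refine (analyticOnNhd_complexMGF (X := id) (μ := ρ)).mono fun z hz => ?_
    exact interior_maximal (fun t ht => hρ t ht) isOpen_Ioo hz
  have h0 : (0:ℝ) ∈ Ioo (-c) c := ⟨by linarith, hc⟩
  have heq : EqOn (complexMGF id μ) (complexMGF id ν) {z : ℂ | z.re ∈ Ioo (-c) c} := by
    refine AnalyticOnNhd.eqOn_of_preconnected_of_frequently_eq
      (hsub μ fun t ht => (h t ht).1) (hsub ν fun t ht => (h t ht).2.1)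
      ((convex_Ioo (-c) c).linear_preimage Complex.reLm).isPreconnected
      (z₀ := ((0:ℝ) : ℂ)) (by simpa using hc) ?_
    have h_real : ∃ᶠ (x : ℝ) in nhdsWithin 0 {0}ᶜ, complexMGF id μ x = complexMGF id ν x := by
      apply Filter.Eventually.frequently
      refine mem_nhdsWithin_of_mem_nhds (Filter.mem_of_superset (isOpen_Ioo.mem_nhds h0) ?_)
      intro t ht
      have := (h t ht).2.2
      simp only [mem_ofPred_eq, complexMGF_ofReal]
      exact congrArg _ this
    rw [Filter.frequently_iff_seq_forall] at h_real ⊢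
    obtain ⟨xs, hx_tendsto, hx_eq⟩ := h_real
    refine ⟨fun n ↦ xs n, ?_, fun n ↦ ?_⟩
    · rw [tendsto_nhdsWithin_iff] at hx_tendsto ⊢
      constructor
      · exact (Complex.continuous_ofReal.tendsto 0).comp hx_tendsto.1
      · simpa using hx_tendsto.2
    · simp [hx_eq]
  apply Measure.ext_of_charFun
  ext t
  rw [← complexMGF_id_mul_I, ← complexMGF_id_mul_I]
  apply heq
  simpa using hc

/-- The kernel of the representation. -/
noncomputable def kerF (α h x : ℝ) : ℝ := (Real.exp ((h - 1) * x) - Real.exp (-x)) * x ^ (-α)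

/-- The tilting weight. -/
noncomputable def kerW (α x : ℝ) : ℝ := kerF α (3/4) x - kerF α (1/2) x

lemma kerW_pos (α x : ℝ) (hx : 0 < x) : 0 < kerW α x := by
  have h1 : Real.exp ((1/2 - 1) * x) < Real.exp ((3/4 - 1) * x) := by
    apply Real.exp_lt_exp.2; linarith
  have h2 : 0 < x ^ (-α) := Real.rpow_pos_of_pos hx _
  unfold kerW kerF
  nlinarith

lemma kerW_measurable (α : ℝ) : Measurable (kerW α) := by
  unfold kerW kerF; fun_prop

lemma exp_mul_kerW (α t x : ℝ) :
    Real.exp (t * x) * kerW α x = kerF α (3/4 + t) x - kerF α (1/2 + t) x := by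
  unfold kerW kerF
  rw [show (3/4 + t - 1) * x = t * x + (3/4 - 1) * x by ring,
    show (1/2 + t - 1) * x = t * x + (1/2 - 1) * x by ring, Real.exp_add, Real.exp_add]
  ring

/-- The tilted measure. -/
noncomputable def tilt (α : ℝ) (Λ : Measure ℝ) : Measure ℝ :=
  (Λ.restrict (Ioi 0)).withDensity (fun x => ENNReal.ofReal (kerW α x))

lemma tilt_inv (α : ℝ) (Λ : Measure ℝ) (h : Λ (Iic 0) = 0) :
    (tilt α Λ).withDensity (fun x => (ENNReal.ofReal (kerW α x))⁻¹) = Λ := by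
  have hr : Λ.restrict (Ioi 0) = Λ := by
    apply Measure.restrict_eq_self_of_ae_mem
    rw [ae_iff]
    convert h using 2
    ext x; simp
  unfold tilt
  have := withDensity_inv_same₀ (μ := Λ.restrict (Ioi 0))
    (f := fun x => ENNReal.ofReal (kerW α x)) (kerW_measurable α).ennreal_ofReal.aemeasurable
    ?_ (ae_of_all _ fun x => ENNReal.ofReal_ne_top)
  · exact this.trans hr
  · filter_upwards [ae_restrict_mem measurableSet_Ioi] with x hx
    simpa using kerW_pos α x hx

lemma tilt_integrable_iff (α : ℝ) (Λ : Measure ℝ) (g : ℝ → ℝ) :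
    Integrable g (tilt α Λ) ↔ IntegrableOn (fun x => g x * kerW α x) (Ioi 0) Λ := by
  unfold tilt
  rw [integrable_withDensity_iff (kerW_measurable α).ennreal_ofReal
    (ae_of_all _ fun x => ENNReal.ofReal_lt_top)]
  refine integrable_congr ?_
  filter_upwards [ae_restrict_mem measurableSet_Ioi] with x hx
  rw [ENNReal.toReal_ofReal (kerW_pos α x hx).le]

lemma tilt_integral (α : ℝ) (Λ : Measure ℝ) (g : ℝ → ℝ) :
    ∫ x, g x ∂(tilt α Λ) = ∫ x in Ioi 0, g x * kerW α x ∂Λ := by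
  unfold tilt
  rw [integral_withDensity_eq_integral_toReal_smul (kerW_measurable α).ennreal_ofReal
    (ae_of_all _ fun x => ENNReal.ofReal_lt_top)]
  refine integral_congr_ae ?_
  filter_upwards [ae_restrict_mem measurableSet_Ioi] with x hx
  rw [ENNReal.toReal_ofReal (kerW_pos α x hx).le, smul_eq_mul, mul_comm]

theorem representing_measure_unique
    (m : ℝ) (hm : m ∈ Set.Ioo (0 : ℝ) 1) (α : ℝ) (hα : α < 1)
    (Λ₁ Λ₂ : Measure ℝ)
    (h₁ : IsLocFiniteOnPos Λ₁) (h₂ : IsLocFiniteOnPos Λ₂)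
    (hs₁ : ScaleInvariant m Λ₁) (hs₂ : ScaleInvariant m Λ₂)
    (hint : ∀ h ∈ Set.Ioo (0 : ℝ) 1,
      IntegrableOn (fun x => (Real.exp ((h - 1) * x) - Real.exp (-x)) * x ^ (-α))
        (Set.Ioi 0) Λ₁ ∧
      IntegrableOn (fun x => (Real.exp ((h - 1) * x) - Real.exp (-x)) * x ^ (-α))
        (Set.Ioi 0) Λ₂ ∧
      ∫ x in Set.Ioi (0 : ℝ), (Real.exp ((h - 1) * x) - Real.exp (-x)) * x ^ (-α) ∂Λ₁ =
        ∫ x in Set.Ioi (0 : ℝ), (Real.exp ((h - 1) * x) - Real.exp (-x)) * x ^ (-α) ∂Λ₂) :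
    Λ₁ = Λ₂ := by
  have e1 : ∀ Λ : Measure ℝ, (∀ h ∈ Ioo (0:ℝ) 1, IntegrableOn (kerF α h) (Ioi 0) Λ) →
      ∀ t ∈ Ioo (-(1/4) : ℝ) (1/4), Integrable (fun x => Real.exp (t * x)) (tilt α Λ) ∧
        ∫ x, Real.exp (t * x) ∂(tilt α Λ) =
          ∫ x in Ioi 0, kerF α (3/4 + t) x ∂Λ - ∫ x in Ioi 0, kerF α (1/2 + t) x ∂Λ := by
    intro Λ hΛ t ht
    have ha := hΛ (3/4 + t) ⟨by linarith [ht.1], by linarith [ht.2]⟩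
    have hb := hΛ (1/2 + t) ⟨by linarith [ht.1], by linarith [ht.2]⟩
    rw [tilt_integrable_iff, tilt_integral]
    simp only [exp_mul_kerW]
    exact ⟨ha.sub hb, integral_sub ha hb⟩
  have i1 := e1 Λ₁ fun h hh => (hint h hh).1
  have i2 := e1 Λ₂ fun h hh => (hint h hh).2.1
  have hfin : ∀ μ : Measure ℝ, Integrable (fun x => Real.exp (0 * x)) μ → IsFiniteMeasure μ := by
    intro μ hμ
    simpa [integrable_const_iff, isFiniteMeasure_iff] using hμ
  have h0 : (0:ℝ) ∈ Ioo (-(1/4) : ℝ) (1/4) := by constructor <;> norm_num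
  have f1 := hfin _ (i1 0 h0).1
  have f2 := hfin _ (i2 0 h0).1
  have key : tilt α Λ₁ = tilt α Λ₂ := by
    refine ext_of_mgf_near_zero _ _ (1/4) (by norm_num) fun t ht =>
      ⟨(i1 t ht).1, (i2 t ht).1, ?_⟩
    rw [(i1 t ht).2, (i2 t ht).2]
    have ea := (hint (3/4 + t) ⟨by linarith [ht.1], by linarith [ht.2]⟩).2.2
    have eb := (hint (1/2 + t) ⟨by linarith [ht.1], by linarith [ht.2]⟩).2.2
    exact congrArg₂ (· - ·) ea eb
  rw [← tilt_inv α Λ₁ h₁.1, ← tilt_inv α Λ₂ h₂.1, key]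
end
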